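/- (Theorem B, necessity.) Let p be an odd prime, q = p^s, r = p^t, k ∈ E(r), l ≥ 1, λ_1,…,λ_l ∈ F_q*, ε_1,ε_2 ∈ F_q*, and let α ∈ F(q) be the continued fraction of type (r,l,k) attached to these data (the unique root with |α| ≥ |T| of the equation y_lX^{r+1} − x_lX^r + (ε_1P_ky_{l−1} − ε_2Q_ky_l)X − ε_1P_kx_{l−1} + ε_2Q_kx_l = 0). Suppose there exists a sequence (λ_n)_{n≥1} in F_q* extending λ_1,…,λ_l such that α is the value of the infinite continued fraction with partial quotients a_n = λ_nA_{i(n)}. Then: (II) for 1 ≤ n ≤ l the finite continued fractions δ_n = 2kθ_k[λ_n^r,…,λ_1^r, 2kθ_kε_2^{−1}] are well defined and lie in F_q*; and (III) either δ_l = 4k²θ_k(ε_1/ε_2)^r, or δ_l ≠ 4k²θ_k(ε_1/ε_2)^r and there exists a sequence (γ_n)_{n≥1} in F_q* satisfying γ_1^r = (4k²θ_kε_1^rδ_l^{−1} − ε_2^r)θ_kδ_1^{−r}, γ_n = γ_{n−1}(δ_nδ_{n−1}ω_k)^{−1} for 2 ≤ n ≤ l, and γ_{f(n)+i} = C_0h_i(γ_n^r)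 for all n ≥ 1 and 0 ≤ i ≤ 2k, where C_0 = γ_lε_1^r(δ_1γ_1)^{−r}(δ_lω_k)^{−1}. -/

import Mathlib

open Polynomial

noncomputable section

/-- The rational numbers `v_{i,k}`: `v 1 = 2k-1`,
`v (i+1) * v i = (2k-2i-1)(2k-2i+1)/(i(2k-i))` for `1 ≤ i ≤ 2k-1`. -/
def vRat (k : ℕ) : ℕ → ℚ
  | 0 => 1
  | 1 => 2 * (k : ℚ) - 1
  | j + 2 =>
      ((2 * (k : ℚ) - 2 * ((j : ℚ) + 1) - 1) * (2 * (k : ℚ) - 2 * ((j : ℚ) + 1) + 1) /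
          (((j : ℚ) + 1) * (2 * (k : ℚ) - ((j : ℚ) + 1)))) / vRat k (j + 1)

/-- Finite continued fraction `[a_1, …, a_n] = a_1 + 1/[a_2, …, a_n]`. -/
def cfl {K : Type*} [DivisionRing K] : List K → K
  | [] => 0
  | [a] => a
  | a :: b :: t => a + (cfl (b :: t))⁻¹

/-- `θ_k = (-1)^k 2^(-2k) C(2k,k)`. -/
def thetaRat (k : ℕ) : ℚ := (-1) ^ k * ((2 : ℚ) ^ (2 * k))⁻¹ * (Nat.choose (2 * k) k : ℚ)

/-- `ω_k = -(2kθ_k)⁻²`. -/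
def omegaRat (k : ℕ) : ℚ := -((2 * (k : ℚ)) * thetaRat k)⁻¹ ^ 2

/-- The coefficients `b_i = (-1)^(k-1-i) C(k-1,i) (2i+1)⁻¹` of `Q_k`. -/
def bRat (k i : ℕ) : ℚ := (-1) ^ (k - 1 - i) * (Nat.choose (k - 1) i : ℚ) * (2 * (i : ℚ) + 1)⁻¹

/-- `k ∈ E(r)` for `r = p^t`: `k = m p^l + (p^l - 1)/2`, `1 ≤ m ≤ (p-1)/2`, `0 ≤ l ≤ t-1`. -/
def memE (p t k : ℕ) : Prop :=
  ∃ m l : ℕ, 1 ≤ m ∧ m ≤ (p - 1) / 2 ∧ l ≤ t - 1 ∧ k = m * p ^ l + (p ^ l - 1) / 2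

/-- Continuant numerators: `x_0 = 1`, `x_1 = a_1`, `x_n = a_n x_{n-1} + x_{n-2}`. -/
def cnum {K : Type*} [Field K] (a : ℕ → K) : ℕ → K
  | 0 => 1
  | 1 => a 1
  | n + 2 => a (n + 2) * cnum a (n + 1) + cnum a n

/-- Continuant denominators: `y_0 = 0`, `y_1 = 1`, `y_n = a_n y_{n-1} + y_{n-2}`. -/
def cden {K : Type*} [Field K] (a : ℕ → K) : ℕ → K
  | 0 => 0
  | 1 => 1
  | n + 2 => a (n + 2) * cden a (n + 1) + cden a n

/-- The element `T` of `F(q) = F_q((T⁻¹))`, realized as the Laurent series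
(in the variable `T⁻¹`) of order `-1`. -/
def Tvar (Fq : Type*) [Field Fq] : LaurentSeries Fq := HahnSeries.single (-1 : ℤ) 1

/-- `P_k(T) = (T² - 1)^k` as an element of `F(q)`. -/
def PkLS (Fq : Type*) [Field Fq] (k : ℕ) : LaurentSeries Fq := (Tvar Fq ^ 2 - 1) ^ k

/-- `Q_k(T) = Σ_{i<k} b̄_i T^(2i+1)` as an element of `F(q)`, the coefficients being
the reductions mod `p` of the rationals `b_i` (`Fq` has characteristic `p`). -/
def QkLS (Fq : Type*) [Field Fq] (k : ℕ) : LaurentSeries Fq :=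
  ∑ i ∈ Finset.range k, algebraMap Fq (LaurentSeries Fq) ((bRat k i : Fq)) * Tvar Fq ^ (2 * i + 1)

/-- The partial quotients `λ_n T` in `F(q)`. -/
def aLin (Fq : Type*) [Field Fq] (lam : ℕ → Fq) (n : ℕ) : LaurentSeries Fq :=
  algebraMap Fq (LaurentSeries Fq) (lam n) * Tvar Fq

/-- The algebraic equation
`y_l X^(r+1) - x_l X^r + (ε₁ P_k y_{l-1} - ε₂ Q_k y_l) X - ε₁ P_k x_{l-1} + ε₂ Q_k x_l = 0`
defining a continued fraction of type `(r, l, k)`, where `x_n, y_n` are the continuants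
of `[λ₁ T, …, λ_l T]`. -/
def CFtypeEqn (Fq : Type*) [Field Fq] (r k l : ℕ) (lam : ℕ → Fq) (e1 e2 : Fq)
    (α : LaurentSeries Fq) : Prop :=
  cden (aLin Fq lam) l * α ^ (r + 1) - cnum (aLin Fq lam) l * α ^ r +
      (algebraMap Fq (LaurentSeries Fq) e1 * PkLS Fq k * cden (aLin Fq lam) (l - 1) -
        algebraMap Fq (LaurentSeries Fq) e2 * QkLS Fq k * cden (aLin Fq lam) l) * α -
      algebraMap Fq (LaurentSeries Fq) e1 * PkLS Fq k * cnum (aLin Fq lam) (l - 1) +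
      algebraMap Fq (LaurentSeries Fq) e2 * QkLS Fq k * cnum (aLin Fq lam) l = 0

/-- `f(n) = (2k+1) n + l - 2k`. -/
def fIdx (k l n : ℕ) : ℕ := (2 * k + 1) * n + l - 2 * k

/-- `i(n) = 1` if `n` is not of the form `f(m)` with `m ≥ 1`, and `i(f(n)) = i(n) + 1`
(for `k ≥ 1`, `l ≥ 1`, the unique `m ≥ 1` with `f(m) = n` is `(n + 2k - l)/(2k+1) < n`). -/
def iIdx (k l : ℕ) : ℕ → ℕ
  | n =>
    if h : 1 ≤ (n + 2 * k - l) / (2 * k + 1) ∧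
        fIdx k l ((n + 2 * k - l) / (2 * k + 1)) = n ∧
        (n + 2 * k - l) / (2 * k + 1) < n then
      iIdx k l ((n + 2 * k - l) / (2 * k + 1)) + 1
    else 1
  termination_by n => n
  decreasing_by exact h.2.2

/-- `A_1 = T`, `A_{i+1} = ⌊A_i^r / P_k⌋` where `P_k = (T²-1)^k` (Euclidean quotient). -/
def Aseq (K : Type*) [Field K] (r k : ℕ) : ℕ → Polynomial K
  | 0 => X
  | 1 => X
  | i + 2 => Aseq K r k (i + 1) ^ r / (X ^ 2 - 1) ^ k

/-- `θ_k` viewed in a field of characteristic `p` (reduction mod `p`). -/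
def thF (Fq : Type*) [Field Fq] (k : ℕ) : Fq := (thetaRat k : Fq)

/-- `ω_k` viewed in a field of characteristic `p` (reduction mod `p`). -/
def omF (Fq : Type*) [Field Fq] (k : ℕ) : Fq := (omegaRat k : Fq)

/-- `v_{i,k}` viewed in a field of characteristic `p` (reduction mod `p`). -/
def vF (Fq : Type*) [Field Fq] (k i : ℕ) : Fq := (vRat k i : Fq)

/-- `w_{i,k} = (-1)^i C(2k-1, i)` viewed in a field of characteristic `p`. -/
def wF (Fq : Type*) [Field Fq] (k i : ℕ) : Fq :=
  ((((-1) ^ i * (Nat.choose (2 * k - 1) i : ℤ)) : ℤ) : Fq)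

/-- The functions `(G)`: `g_0(x) = θ_k + x`, `g_{2k}(x) = (θ_k - x)⁻¹`, and
`g_i(x) = 2kθ_k v_{i,k} (i/(2k-2i+1)) (θ_k + w_{i,k} x)/(θ_k + w_{i-1,k} x)` for `1 ≤ i ≤ 2k-1`. -/
def gF (Fq : Type*) [Field Fq] (k i : ℕ) (x : Fq) : Fq :=
  if i = 0 then thF Fq k + x
  else if i = 2 * k then (thF Fq k - x)⁻¹
  else 2 * (k : Fq) * thF Fq k * vF Fq k i *
    ((i : Fq) * (((2 * (k : ℤ) - 2 * i + 1) : ℤ) : Fq)⁻¹) *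
    (thF Fq k + wF Fq k i * x) * (thF Fq k + wF Fq k (i - 1) * x)⁻¹

/-- The functions `(H)`: `h_0(x) = x/(θ_k + x)`, `h_{2k}(x) = x/(θ_k - x)`, and
`h_i(x) = (-1)^i C(2k,i) θ_k x/((θ_k + w_{i,k} x)(θ_k + w_{i-1,k} x))` for `1 ≤ i ≤ 2k-1`. -/
def hF (Fq : Type*) [Field Fq] (k i : ℕ) (x : Fq) : Fq :=
  if i = 0 then x * (thF Fq k + x)⁻¹
  else if i = 2 * k then x * (thF Fq k - x)⁻¹
  else ((((-1) ^ i * (Nat.choose (2 * k) i : ℤ)) : ℤ) : Fq) * thF Fq k * x *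
    ((thF Fq k + wF Fq k i * x) * (thF Fq k + wF Fq k (i - 1) * x))⁻¹

/-- The image in `F(q)` of a polynomial in `F_q[T]`. -/
def polyT (Fq : Type*) [Field Fq] (P : Polynomial Fq) : LaurentSeries Fq :=
  Polynomial.aeval (Tvar Fq) P

/-- The partial quotients `a_n = λ_n A_{i(n)}` viewed in `F(q)`. -/
def aPQ (Fq : Type*) [Field Fq] (r k l : ℕ) (lam : ℕ → Fq) (n : ℕ) : LaurentSeries Fq :=
  algebraMap Fq (LaurentSeries Fq) (lam n) * polyT Fq (Aseq Fq r k (iIdx k l n))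

/-- `α` is the value of the infinite continued fraction with partial quotients `a_n`:
the convergents `x_n/y_n` tend to `α` in the valuation topology of `F(q)`. -/
def ConvergesTo (Fq : Type*) [Field Fq] (a : ℕ → LaurentSeries Fq) (α : LaurentSeries Fq) :
    Prop :=
  Filter.Tendsto (fun n => cnum a n / cden a n) Filter.atTop (nhds α)

/-- The list `[λ_n^r, λ_{n-1}^r, …, λ_1^r, 2kθ_k ε₂⁻¹]` whose continued fraction value,
multiplied by `2kθ_k`, is `δ_n` (condition `(II)`). -/
def deltaList (Fq : Type*) [Field Fq] (r k : ℕ) (e2 : Fq) (lam : ℕ → Fq) (n : ℕ) : List Fq :=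
  ((List.range n).map fun j => lam (n - j) ^ r) ++ [2 * (k : Fq) * thF Fq k * e2⁻¹]

theorem choose_ne_zero_of_add_one_eq {p : ℕ} [Fact p.Prime] (K : Type*) [Field K] [CharP K p]
    (m j : ℕ) (hm : 2 * m + 1 ≤ p) :
    ∀ N n : ℕ, N + 1 = (2 * m + 1) * p ^ j → n ≤ N → ((N.choose n : ℕ) : K) ≠ 0 := by
  have hp := Fact.out (p := p.Prime)
  have small : ∀ N n : ℕ, N < p → n ≤ N → ¬ p ∣ N.choose n := fun N n hN hn h => by
    have : p ∣ N.factorial := by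
      rw [← Nat.choose_mul_factorial_mul_factorial hn, mul_assoc]
      exact h.mul_right _
    exact absurd (hp.dvd_factorial.1 this) (by omega)
  induction j with
  | zero =>
    intro N n hN hn
    rw [Ne, CharP.cast_eq_zero_iff K p]
    exact small N n (by simp at hN; omega) hn
  | succ j ih =>
    intro N n hN hn
    have hpos : 0 < (2 * m + 1) * p ^ j := Nat.mul_pos (by omega) (pow_pos hp.pos _)
    obtain ⟨N', hN'⟩ : ∃ N', N' + 1 = (2 * m + 1) * p ^ j := ⟨_, Nat.succ_pred_eq_of_pos hpos⟩
    have hNN : N = p * N' + (p - 1) := by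
      have h1 : N + 1 = p * (N' + 1) := by rw [hN, hN', pow_succ]; ring
      have := hp.pos
      rw [mul_add] at h1
      omega
    have hdiv : N / p = N' := by
      rw [hNN, Nat.mul_add_div hp.pos, Nat.div_eq_of_lt (Nat.sub_lt hp.pos one_pos), add_zero]
    have hmod : N % p = p - 1 := by
      rw [hNN, Nat.mul_add_mod, Nat.mod_eq_of_lt (Nat.sub_lt hp.pos one_pos)]
    rw [Ne, CharP.cast_eq_zero_iff K p]
    have key := Choose.choose_modEq_choose_mod_mul_choose_div_nat (n := N) (k := n) (p := p)
    rw [(Nat.ModEq.dvd_iff key dvd_rfl), hdiv, hmod, hp.dvd_mul, not_or]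
    refine ⟨small _ _ (Nat.sub_lt hp.pos one_pos)
      (Nat.le_sub_one_of_lt (Nat.mod_lt _ hp.pos)), ?_⟩
    have := ih N' (n / p) hN' (hdiv ▸ Nat.div_le_div_right hn)
    rwa [Ne, CharP.cast_eq_zero_iff K p] at this

/-- The ratio `C(2k, n + 1) / C(2k, n)`. -/
noncomputable def chooseRatio (K : Type*) [Field K] (k n : ℕ) : K :=
  ((2 * k).choose (n + 1) : K) / ((2 * k).choose n : K)

/-- The continuants of the block `(1 - C(2k, n + 1) / C(2k, n)) X`, weighted by
`C(2k, n + 1) / C(2k, n)`; up to scaling they are Gegenbauer polynomials. -/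
noncomputable def geg (K : Type*) [Field K] (k : ℕ) : ℕ → K[X]
  | 0 => 0
  | 1 => 1
  | n + 2 => C (1 - chooseRatio K k n) * X * geg K k (n + 1) + C (chooseRatio K k n) * geg K k n

/-- The coefficient of `X ^ i` in `geg ℚ k (i + 2 * j + 1)`. -/
noncomputable def gegCoeff (k i j : ℕ) : ℚ :=
  (-1) ^ j * 2 ^ i * (ascPochhammer ℚ (i + j)).eval (1 / 2 - (k : ℚ)) / (i.factorial * j.factorial)

theorem chooseRatio_rat {k n : ℕ} (hn : n ≤ 2 * k) :
    chooseRatio ℚ k n = (2 * k - n) / (n + 1) := by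
  have h := Nat.choose_succ_right_eq (2 * k) n
  have h0 : ((2 * k).choose n : ℚ) ≠ 0 := by exact_mod_cast (Nat.choose_pos hn).ne'
  have h1 : ((2 * k).choose (n + 1) : ℚ) * (n + 1) = (2 * k).choose n * (2 * k - n) := by
    have := congrArg (Nat.cast : ℕ → ℚ) h
    push_cast [Nat.cast_sub hn] at this
    exact this
  have h2 : (n : ℚ) + 1 ≠ 0 := by positivity
  rw [chooseRatio, div_eq_div_iff h0 h2, h1]; ring

theorem coeff_geg_rat (k : ℕ) : ∀ n, n ≤ 2 * k →
    (∀ i j, i + 2 * j = n → (geg ℚ k (n + 1)).coeff i = gegCoeff k i j) ∧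
    ∀ i, (∀ j, i + 2 * j ≠ n) → (geg ℚ k (n + 1)).coeff i = 0 := by
  intro n
  induction n using Nat.twoStepInduction with
  | zero =>
    intro _
    constructor
    · intro i j h
      obtain ⟨rfl, rfl⟩ : i = 0 ∧ j = 0 := by omega
      simp [geg, gegCoeff]
    · intro i h
      have : i ≠ 0 := fun h0 => h 0 (by omega)
      simp [geg, coeff_one, this]
  | one =>
    intro hk
    have hg : geg ℚ k (1 + 1) = C (1 - 2 * (k : ℚ)) * X := by
      simp [geg, chooseRatio]
    rw [hg]
    constructor
    · intro i j h
      obtain ⟨rfl, rfl⟩ : i = 1 ∧ j = 0 := by omega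
      simp [gegCoeff]; ring
    · intro i h
      have : 1 ≠ i := fun h0 => h 0 (by omega)
      rw [coeff_C_mul, coeff_X, if_neg this, mul_zero]
  | more n ih1 ih2 =>
    intro hn
    obtain ⟨ih1a, ih1b⟩ := ih1 (by omega)
    obtain ⟨ih2a, ih2b⟩ := ih2 (by omega)
    have hg : geg ℚ k (n + 2 + 1) = C (1 - chooseRatio ℚ k (n + 1)) * (X * geg ℚ k (n + 1 + 1))
      + C (chooseRatio ℚ k (n + 1)) * geg ℚ k (n + 1) := by rw [geg, mul_assoc]
    rw [hg, chooseRatio_rat (by omega)]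
    constructor
    · intro i j h
      rw [coeff_add, coeff_C_mul, coeff_C_mul]
      rcases i with _ | i
      · obtain ⟨j, rfl⟩ : ∃ m, j = m + 1 := ⟨j - 1, by omega⟩
        rw [coeff_X_mul_zero, ih1a 0 j (by omega)]
        obtain rfl : n = 2 * j := by omega
        have : (j : ℚ) + 1 ≠ 0 := by positivity
        have : (j.factorial : ℚ) ≠ 0 := by positivity
        simp only [gegCoeff, ← add_assoc, zero_add, ascPochhammer_succ_eval, Nat.factorial_succ]
        push_cast
        field_simp
        ring
      · rw [coeff_X_mul, ih2a i j (by omega)]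
        have : (i : ℚ) + 1 ≠ 0 := by positivity
        have : (i.factorial : ℚ) ≠ 0 := by positivity
        rcases j with _ | j
        · rw [ih1b (i + 1) (by intro j; omega)]
          obtain rfl : i = n + 1 := by omega
          simp only [gegCoeff, add_zero, ascPochhammer_succ_eval, Nat.factorial_succ]
          push_cast at *
          have : (n : ℚ) + 2 ≠ 0 := by positivity
          have : (n : ℚ) + 1 + 1 ≠ 0 := by positivity
          field_simp
          ring
        · rw [ih1a (i + 1) j (by omega)]
          obtain rfl : n = i + 2 * j + 1 := by omega
          have e1 : i + (j + 1) = i + j + 1 := by ring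
          have e2 : i + 1 + j = i + j + 1 := by ring
          have e3 : i + 1 + (j + 1) = i + j + 1 + 1 := by ring
          simp only [gegCoeff, e1, e2, e3, ascPochhammer_succ_eval, Nat.factorial_succ]
          have : (j : ℚ) + 1 ≠ 0 := by positivity
          have : (j.factorial : ℚ) ≠ 0 := by positivity
          push_cast
          have : (i + 2 * j + 1 + 1 : ℚ) + 1 ≠ 0 := by positivity
          field_simp
          ring
    · intro i h
      rw [coeff_add, coeff_C_mul, coeff_C_mul, ih1b i (fun j hj => h (j + 1) (by omega))]
      rcases i with _ | i
      · simp
      · rw [coeff_X_mul, ih2b i (fun j hj => h j (by omega))]; simp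

theorem ascPochhammer_eval_half_sub (k a : ℕ) :
    (ascPochhammer ℚ (k + a)).eval (1 / 2 - (k : ℚ)) * (4 ^ a * a.factorial * (4 ^ k * k.factorial))
      = (-1) ^ k * (2 * k).factorial * (2 * a).factorial := by
  induction a with
  | zero =>
    simp only [add_zero, pow_zero, Nat.factorial_zero, mul_zero, Nat.cast_one, one_mul, mul_one]
    induction k with
    | zero => simp
    | succ k ih =>
      rw [ascPochhammer_succ_left]
      have e : (1 / 2 - ((k + 1 : ℕ) : ℚ)) + 1 = 1 / 2 - k := by push_cast; ring
      simp only [eval_mul, eval_X, eval_comp, eval_add, eval_one, e]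
      have e2 : 2 * (k + 1) = 2 * k + 1 + 1 := by ring
      rw [e2, Nat.factorial_succ, Nat.factorial_succ, Nat.factorial_succ]
      push_cast
      linear_combination (1 / 2 - (k + 1 : ℚ)) * 4 * (k + 1) * ih
  | succ a ih =>
    rw [← add_assoc, ascPochhammer_succ_eval]
    have e2 : 2 * (a + 1) = 2 * a + 1 + 1 := by ring
    rw [e2, Nat.factorial_succ, Nat.factorial_succ, Nat.factorial_succ]
    push_cast
    linear_combination (1 / 2 + a : ℚ) * 4 * (a + 1) * ih


theorem coeff_X_sq_sub_one_pow {R : Type*} [CommRing R] (k i : ℕ) :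
    ((X ^ 2 - 1 : R[X]) ^ k).coeff i =
      if 2 ∣ i then (-1) ^ (k - i / 2) * (k.choose (i / 2) : R) else 0 := by
  have : ((X ^ 2 - 1 : R[X]) ^ k) = expand R 2 ((X + C (-1)) ^ k) := by
    simp [sub_eq_add_neg]
  rw [this, coeff_expand two_pos, coeff_X_add_C_pow]

/-- `Q_k` as a polynomial. -/
noncomputable def Qpoly (K : Type*) [Field K] (k : ℕ) : K[X] :=
  ∑ i ∈ Finset.range k, C (bRat k i : K) * X ^ (2 * i + 1)

theorem coeff_Qpoly (K : Type*) [Field K] (k a : ℕ) (ha : a < k) :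
    (Qpoly K k).coeff (2 * a + 1) = (bRat k a : K) := by
  rw [Qpoly, finsetSum_coeff, Finset.sum_eq_single_of_mem a (Finset.mem_range.2 ha)]
  · simp
  · intro b _ hb
    rw [coeff_C_mul_X_pow, if_neg (by omega)]

theorem coeff_Qpoly_eq_zero (K : Type*) [Field K] (k m : ℕ) (hm : ∀ a < k, m ≠ 2 * a + 1) :
    (Qpoly K k).coeff m = 0 := by
  rw [Qpoly, finsetSum_coeff]
  refine Finset.sum_eq_zero fun b hb => ?_
  rw [coeff_C_mul_X_pow, if_neg (hm b (Finset.mem_range.1 hb))]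

theorem geg_rat_top (k : ℕ) : geg ℚ k (2 * k + 1) = C (thetaRat k) * (X ^ 2 - 1) ^ k := by
  ext i
  obtain ⟨h1, h2⟩ := coeff_geg_rat k (2 * k) le_rfl
  rw [coeff_C_mul, coeff_X_sq_sub_one_pow]
  split_ifs with hi
  · obtain ⟨a, rfl⟩ := hi
    rw [Nat.mul_div_cancel_left _ two_pos]
    rcases le_or_gt a k with ha | ha
    · obtain ⟨b, rfl⟩ := Nat.exists_eq_add_of_le ha
      rw [h1 (2 * a) b (by ring), gegCoeff, thetaRat, Nat.add_sub_cancel_left]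
      have hp := ascPochhammer_eval_half_sub (a + b) a
      have c1 := Nat.add_choose_mul_factorial_mul_factorial a b
      have c2 := Nat.choose_mul_factorial_mul_factorial (n := 2 * (a + b)) (k := a + b) (by omega)
      rw [show 2 * (a + b) - (a + b) = a + b by omega] at c2
      rw [show 2 * a + b = a + b + a by ring]
      rw [← c2, ← c1, ← Nat.choose_symm_add] at hp
      generalize eval _ (ascPochhammer ℚ _) = E at hp ⊢
      push_cast at hp
      have f1 : (a.factorial : ℚ) ≠ 0 := by positivity
      have f2 : (b.factorial : ℚ) ≠ 0 := by positivity
      have f3 : ((2 * a).factorial : ℚ) ≠ 0 := by positivity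
      have f4 : ((a + b).choose a : ℚ) ≠ 0 := by
        exact_mod_cast (Nat.choose_pos (by omega)).ne'
      rw [show (2 : ℚ) ^ (2 * a) = 4 ^ a by rw [pow_mul]; norm_num,
        show (2 : ℚ) ^ (2 * (a + b)) = 4 ^ (a + b) by rw [pow_mul]; norm_num]
      rw [div_eq_iff (by positivity)]
      have f5 : (4 : ℚ) ^ (a + b) ≠ 0 := by positivity
      have f6 : ((a.factorial : ℚ) * (4 ^ (a + b) * ((a + b).choose a * a.factorial * b.factorial))) ≠ 0 :=
        by positivity
      field_simp
      refine mul_left_cancel₀ (mul_ne_zero f1 (mul_ne_zero f4 (mul_ne_zero f1 f2))) ?_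
      linear_combination hp
    · rw [h2 _ (by intro j; omega), Nat.choose_eq_zero_of_lt ha]; simp
  · rw [h2 _ (by intro j; omega), mul_zero]

theorem geg_rat_pred_top (k : ℕ) (hk : 1 ≤ k) :
    geg ℚ k (2 * k) = C (2 * k * thetaRat k) * Qpoly ℚ k := by
  obtain ⟨k, rfl⟩ : ∃ m, k = m + 1 := ⟨k - 1, by omega⟩
  ext i
  obtain ⟨h1, h2⟩ := coeff_geg_rat (k + 1) (2 * k + 1) (by omega)
  rw [show 2 * (k + 1) = 2 * k + 1 + 1 by ring, coeff_C_mul]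
  by_cases hi : ∃ a, a < k + 1 ∧ i = 2 * a + 1
  · obtain ⟨a, ha, rfl⟩ := hi
    rw [coeff_Qpoly _ _ _ ha, Rat.cast_id]
    obtain ⟨b, rfl⟩ := Nat.exists_eq_add_of_le (Nat.lt_succ_iff.1 ha)
    rw [h1 (2 * a + 1) b (by ring), gegCoeff, thetaRat, bRat,
      show a + b + 1 - 1 - a = b by omega, show a + b + 1 - 1 = a + b by omega]
    have hp := ascPochhammer_eval_half_sub (a + b + 1) a
    have c1 := Nat.add_choose_mul_factorial_mul_factorial a b
    have c2 := Nat.choose_mul_factorial_mul_factorial (n := 2 * (a + b + 1)) (k := a + b + 1)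
      (by omega)
    rw [show 2 * (a + b + 1) - (a + b + 1) = a + b + 1 by omega] at c2
    rw [show 2 * a + 1 + b = a + b + 1 + a by ring]
    rw [← c2, Nat.factorial_succ (a + b), ← c1, ← Nat.choose_symm_add] at hp
    generalize eval _ (ascPochhammer ℚ _) = E at hp ⊢
    push_cast at hp
    rw [Nat.factorial_succ (2 * a)]
    push_cast
    have f1 : (a.factorial : ℚ) ≠ 0 := by positivity
    have f2 : (b.factorial : ℚ) ≠ 0 := by positivity
    have f3 : ((2 * a).factorial : ℚ) ≠ 0 := by positivity
    have f4 : ((a + b).choose a : ℚ) ≠ 0 := by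
      exact_mod_cast (Nat.choose_pos (by omega)).ne'
    rw [show (2 : ℚ) ^ (2 * a + 1) = 2 * 4 ^ a by rw [pow_succ, pow_mul]; norm_num; ring,
      show (2 : ℚ) ^ (2 * (a + b + 1)) = 4 ^ (a + b + 1) by rw [pow_mul]; norm_num]
    rw [div_eq_iff (by positivity)]
    have f5 : (4 : ℚ) ^ (a + b + 1) ≠ 0 := by positivity
    have f6 : (2 * a + 1 : ℚ) ≠ 0 := by positivity
    have f7 : (a + b + 1 : ℚ) ≠ 0 := by positivity
    field_simp
    refine mul_left_cancel₀
      (mul_ne_zero f7 (mul_ne_zero f1 (mul_ne_zero f4 (mul_ne_zero f1 f2)))) ?_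
    linear_combination hp
  · push Not at hi
    rw [coeff_Qpoly_eq_zero _ _ _ hi, mul_zero]
    refine h2 i fun j hj => hi ((i - 1) / 2) ?_ ?_ <;> omega

/-- `x : K` is the reduction of the rational number `q`. -/
def RatRed (K : Type*) [Field K] (q : ℚ) (x : K) : Prop :=
  ∃ a b : ℤ, (b : K) ≠ 0 ∧ q * b = a ∧ x * b = a

namespace RatRed
variable {K : Type*} [Field K] {q q' : ℚ} {x x' : K}

theorem intCast (n : ℤ) : RatRed K n n := ⟨n, 1, by simp, by simp, by simp⟩

theorem natCast (n : ℕ) : RatRed K n n := ⟨n, 1, by simp, by simp, by simp⟩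

theorem add (h : RatRed K q x) (h' : RatRed K q' x') : RatRed K (q + q') (x + x') := by
  obtain ⟨a, b, h1, h2, h3⟩ := h
  obtain ⟨a', b', h1', h2', h3'⟩ := h'
  refine ⟨a * b' + a' * b, b * b', by push_cast; exact mul_ne_zero h1 h1', ?_, ?_⟩
  · push_cast; linear_combination (b' : ℚ) * h2 + b * h2'
  · push_cast; linear_combination (b' : K) * h3 + b * h3'

theorem mul (h : RatRed K q x) (h' : RatRed K q' x') : RatRed K (q * q') (x * x') := by
  obtain ⟨a, b, h1, h2, h3⟩ := h
  obtain ⟨a', b', h1', h2', h3'⟩ := h'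
  refine ⟨a * a', b * b', by push_cast; exact mul_ne_zero h1 h1', ?_, ?_⟩
  · push_cast; rw [← h2, ← h2']; ring
  · push_cast; rw [← h3, ← h3']; ring

theorem sub (h : RatRed K q x) (h' : RatRed K q' x') : RatRed K (q - q') (x - x') := by
  simpa [sub_eq_add_neg] using h.add ((intCast (-1)).mul h')

theorem pow (h : RatRed K q x) (n : ℕ) : RatRed K (q ^ n) (x ^ n) := by
  induction n with
  | zero => simpa using natCast (K := K) 1
  | succ n ih => rw [pow_succ, pow_succ]; exact ih.mul h

theorem inv (h : RatRed K q x) (hx : x ≠ 0) : RatRed K q⁻¹ x⁻¹ := by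
  obtain ⟨a, b, h1, h2, h3⟩ := h
  have ha : (a : K) ≠ 0 := h3 ▸ mul_ne_zero hx h1
  have ha' : (a : ℚ) ≠ 0 := by
    intro h0
    rw [Int.cast_eq_zero.1 h0] at ha
    simp at ha
  have hq : q ≠ 0 := by rintro rfl; simp at h2; simp [← h2] at ha'
  exact ⟨b, a, ha, by rw [← h2, inv_mul_cancel_left₀ hq], by rw [← h3, inv_mul_cancel_left₀ hx]⟩

theorem div (h : RatRed K q x) (h' : RatRed K q' x') (hx : x' ≠ 0) :
    RatRed K (q / q') (x / x') := by
  rw [div_eq_mul_inv, div_eq_mul_inv]; exact h.mul (h'.inv hx)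

theorem cast_eq (h : RatRed K q x) : (q : K) = x := by
  obtain ⟨a, b, h1, h2, h3⟩ := h
  have hb : (b : ℚ) ≠ 0 := by
    intro h0
    rw [Int.cast_eq_zero.1 h0] at h1
    simp at h1
  rw [eq_div_of_mul_eq hb h2, ← Rat.divInt_eq_div, Rat.cast_divInt_of_ne_zero _ h1,
    eq_div_of_mul_eq h1 h3]

end RatRed

section Reduction
variable {K : Type*} [Field K] {k : ℕ}

theorem chooseRatio_red (hB : ∀ n ≤ 2 * k, ((2 * k).choose n : K) ≠ 0) {n : ℕ} (hn : n ≤ 2 * k) :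
    RatRed K (chooseRatio ℚ k n) (chooseRatio K k n) :=
  (RatRed.natCast _).div (RatRed.natCast _) (hB n hn)

theorem coeff_geg_red (hB : ∀ n ≤ 2 * k, ((2 * k).choose n : K) ≠ 0) :
    ∀ n, n ≤ 2 * k + 1 → ∀ i, RatRed K ((geg ℚ k n).coeff i) ((geg K k n).coeff i) := by
  intro n
  induction n using Nat.twoStepInduction with
  | zero => intro _ i; simpa [geg] using RatRed.natCast (K := K) 0
  | one =>
    intro _ i
    simp only [geg, coeff_one]
    split_ifs
    · simpa using RatRed.natCast (K := K) 1
    · simpa using RatRed.natCast (K := K) 0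
  | more n ih1 ih2 =>
    intro hn i
    have hr := chooseRatio_red hB (n := n) (by omega)
    have h1 : RatRed K 1 1 := by simpa using RatRed.natCast (K := K) 1
    simp only [geg, mul_assoc, coeff_add, coeff_C_mul]
    refine ((h1.sub hr).mul ?_).add (hr.mul (ih1 (by omega) i))
    rcases i with _ | i
    · simpa using RatRed.natCast (K := K) 0
    · simpa [coeff_X_mul] using ih2 (by omega) i

theorem thetaRat_red (h2 : (2 : K) ≠ 0) :
    RatRed K (thetaRat k) ((-1) ^ k * (2 ^ (2 * k))⁻¹ * ((2 * k).choose k : K)) := by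
  have hm : RatRed K (-1) (-1) := by simpa using RatRed.intCast (K := K) (-1)
  have h2' : RatRed K 2 2 := by simpa using RatRed.natCast (K := K) 2
  exact ((hm.pow k).mul ((h2'.pow _).inv (pow_ne_zero _ h2))).mul (RatRed.natCast _)

theorem thF_eq (h2 : (2 : K) ≠ 0) :
    thF K k = (-1) ^ k * (2 ^ (2 * k))⁻¹ * ((2 * k).choose k : K) := (thetaRat_red h2).cast_eq

theorem thF_ne_zero (h2 : (2 : K) ≠ 0) (hB : ∀ n ≤ 2 * k, ((2 * k).choose n : K) ≠ 0) :
    thF K k ≠ 0 := by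
  rw [thF_eq h2]
  exact mul_ne_zero (mul_ne_zero (by simp) (inv_ne_zero (pow_ne_zero _ h2))) (hB k (by omega))

theorem thF_red (h2 : (2 : K) ≠ 0) : RatRed K (thetaRat k) (thF K k) :=
  thF_eq (K := K) h2 ▸ thetaRat_red h2

theorem kappa_red (h2 : (2 : K) ≠ 0) :
    RatRed K (2 * k * thetaRat k) (2 * (k : K) * thF K k) :=
  (RatRed.mul (by simpa using RatRed.natCast (K := K) 2) (RatRed.natCast k)).mul (thF_red h2)

theorem omF_eq (h2 : (2 : K) ≠ 0) (hκ : 2 * (k : K) * thF K k ≠ 0) :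
    omF K k = -(2 * (k : K) * thF K k)⁻¹ ^ 2 := by
  have hm : RatRed K (-1) (-1) := by simpa using RatRed.intCast (K := K) (-1)
  have := (hm.mul (((kappa_red (k := k) h2).inv hκ).pow 2)).cast_eq
  rw [omF, omegaRat, ← neg_one_mul, this, neg_one_mul]

theorem geg_top (h2 : (2 : K) ≠ 0) (hB : ∀ n ≤ 2 * k, ((2 * k).choose n : K) ≠ 0) :
    geg K k (2 * k + 1) = C (thF K k) * (X ^ 2 - 1) ^ k := by
  ext i
  rw [← (coeff_geg_red hB _ le_rfl i).cast_eq, geg_rat_top, coeff_C_mul, coeff_C_mul,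
    coeff_X_sq_sub_one_pow, coeff_X_sq_sub_one_pow]
  have hm : RatRed K (-1) (-1) := by simpa using RatRed.intCast (K := K) (-1)
  split_ifs
  · exact ((thF_red h2).mul ((hm.pow _).mul (RatRed.natCast _))).cast_eq
  · simp

theorem bRat_red (h2 : (2 : K) ≠ 0) (hκ : 2 * (k : K) * thF K k ≠ 0)
    (hB : ∀ n ≤ 2 * k, ((2 * k).choose n : K) ≠ 0) {a : ℕ} (ha : a < k) :
    RatRed K (bRat k a) (bRat k a : K) := by
  have h := coeff_geg_red hB (2 * k) (by omega) (2 * a + 1)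
  rw [geg_rat_pred_top k (by omega), coeff_C_mul, coeff_Qpoly _ _ _ ha, Rat.cast_id] at h
  have hq : (2 * k * thetaRat k : ℚ) ≠ 0 := by
    rintro h0
    have := (kappa_red (K := K) (k := k) h2).cast_eq
    rw [h0, Rat.cast_zero] at this
    exact hκ this.symm
  have := h.div (kappa_red (K := K) (k := k) h2) hκ
  rw [mul_div_cancel_left₀ _ hq] at this
  rwa [this.cast_eq]

theorem geg_pred_top (hk : 1 ≤ k) (h2 : (2 : K) ≠ 0) (hκ : 2 * (k : K) * thF K k ≠ 0)
    (hB : ∀ n ≤ 2 * k, ((2 * k).choose n : K) ≠ 0) :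
    geg K k (2 * k) = C (2 * (k : K) * thF K k) * Qpoly K k := by
  ext i
  rw [← (coeff_geg_red hB _ (by omega) i).cast_eq, geg_rat_pred_top k hk, coeff_C_mul, coeff_C_mul]
  by_cases hi : ∃ a, a < k ∧ i = 2 * a + 1
  · obtain ⟨a, ha, rfl⟩ := hi
    rw [coeff_Qpoly _ _ _ ha, coeff_Qpoly _ _ _ ha, Rat.cast_id]
    exact ((kappa_red h2).mul (bRat_red h2 hκ hB ha)).cast_eq
  · push Not at hi
    rw [coeff_Qpoly_eq_zero _ _ _ hi, coeff_Qpoly_eq_zero _ _ _ hi]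
    simp

theorem derivative_Qpoly (h2 : (2 : K) ≠ 0) (hκ : 2 * (k : K) * thF K k ≠ 0)
    (hB : ∀ n ≤ 2 * k, ((2 * k).choose n : K) ≠ 0) (hk : 1 ≤ k) :
    derivative (Qpoly K k) = (X ^ 2 - 1) ^ (k - 1) := by
  ext m
  rw [coeff_derivative, coeff_X_sq_sub_one_pow]
  by_cases hm : ∃ a, a < k ∧ m = 2 * a
  · obtain ⟨a, ha, rfl⟩ := hm
    rw [if_pos ⟨a, rfl⟩, coeff_Qpoly _ _ _ ha, Nat.mul_div_cancel_left _ two_pos]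
    have h := (bRat_red h2 hκ hB ha).mul (RatRed.natCast (K := K) (2 * a + 1))
    have h' : bRat k a * ((2 * a + 1 : ℕ) : ℚ) =
        (((-1) ^ (k - 1 - a) * ((k - 1).choose a : ℤ) : ℤ) : ℚ) := by
      have : (2 * (a : ℚ) + 1) ≠ 0 := by positivity
      rw [bRat]
      push_cast
      rw [mul_assoc, inv_mul_cancel₀ this, mul_one]
    rw [h'] at h
    have := h.cast_eq
    push_cast at this
    push_cast
    rw [← this]
    have := (RatRed.intCast (K := K) ((-1) ^ (k - 1 - a) * ((k - 1).choose a : ℤ))).cast_eq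
    push_cast at this
    exact this
  · push Not at hm
    rw [coeff_Qpoly_eq_zero _ _ _ (fun a ha h => hm a ha (by omega)), zero_mul]
    split_ifs with h
    · obtain ⟨a, rfl⟩ := h
      have : k ≤ a := by by_contra h; exact hm a (by omega) rfl
      rw [Nat.mul_div_cancel_left _ two_pos, Nat.choose_eq_zero_of_lt (by omega)]; simp
    · rfl

end Reduction

section PartialQuotients
variable {K : Type*} [Field K] {k : ℕ}

theorem chooseRatio_ne_zero (hB : ∀ n ≤ 2 * k, ((2 * k).choose n : K) ≠ 0) {j : ℕ}
    (hj : j < 2 * k) : chooseRatio K k j ≠ 0 :=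
  div_ne_zero (hB _ hj) (hB _ hj.le)

theorem chooseRatio_symm {i j : ℕ} (h : i + j + 1 = 2 * k) :
    chooseRatio K k j = (chooseRatio K k i)⁻¹ := by
  rw [chooseRatio, chooseRatio, inv_div, ← h]
  congr 2
  · exact Nat.choose_symm_of_eq_add (by omega)
  · exact Nat.choose_symm_of_eq_add (by omega)

theorem geg_add_two (n : ℕ) : geg K k (n + 2) =
    C (1 - chooseRatio K k n) * X * geg K k (n + 1) + C (chooseRatio K k n) * geg K k n := by
  rw [geg]

/-- The recurrence of `geg`, run backwards, is the same recurrence. -/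
theorem geg_eq_of_add_eq (hB : ∀ n ≤ 2 * k, ((2 * k).choose n : K) ≠ 0) {i j : ℕ}
    (h : i + j + 1 = 2 * k) : geg K k j =
      C (1 - chooseRatio K k i) * X * geg K k (j + 1) + C (chooseRatio K k i) * geg K k (j + 2) := by
  have h0 := chooseRatio_ne_zero hB (j := i) (by omega)
  rw [geg, chooseRatio_symm h]
  have e : C (chooseRatio K k i) * C (chooseRatio K k i)⁻¹ = 1 := by
    rw [← C_mul, mul_inv_cancel₀ h0, C_1]
  simp only [C_sub, C_1]
  linear_combination (X * geg K k (j + 1) - geg K k j) * e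

theorem natDegree_geg_le (n : ℕ) : (geg K k (n + 1)).natDegree ≤ n := by
  induction n using Nat.twoStepInduction with
  | zero => simp [geg]
  | one => simpa [geg] using natDegree_C_mul_X_pow_le (1 - chooseRatio K k 0) 1
  | more n ih1 ih2 =>
    rw [geg]
    refine natDegree_add_le_of_degree_le ?_ ((natDegree_C_mul_le _ _).trans (by omega))
    rw [mul_assoc]
    refine (natDegree_C_mul_le _ _).trans (natDegree_mul_le.trans ?_)
    rw [natDegree_X]; omega

theorem geg_top_dvd_sub (hB : ∀ n ≤ 2 * k, ((2 * k).choose n : K) ≠ 0) :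
    ∀ i j, i + j = 2 * k + 1 → geg K k (2 * k + 1) ∣ geg K k j - geg K k (2 * k) * geg K k i := by
  intro i
  induction i using Nat.twoStepInduction with
  | zero => intro j hj; obtain rfl : j = 2 * k + 1 := by omega
            simp [geg]
  | one => intro j hj; obtain rfl : j = 2 * k := by omega
           simp [geg]
  | more i ih1 ih2 =>
    intro j hj
    have h1 := ih1 (j + 2) (by omega)
    have h2 := ih2 (j + 1) (by omega)
    have : geg K k j - geg K k (2 * k) * geg K k (i + 2) =
        C (chooseRatio K k i) * (geg K k (j + 2) - geg K k (2 * k) * geg K k i) +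
        C (1 - chooseRatio K k i) * X * (geg K k (j + 1) - geg K k (2 * k) * geg K k (i + 1)) := by
      rw [geg_eq_of_add_eq hB (show i + j + 1 = 2 * k by omega), geg_add_two i]
      ring
    rw [this]
    exact dvd_add (h1.mul_left _) (h2.mul_left _)

theorem wF_succ_sub (j : ℕ) (hk : 1 ≤ k) :
    wF K k (j + 1) - wF K k j = (-1) ^ (j + 1) * ((2 * k).choose (j + 1) : K) := by
  obtain ⟨m, hm⟩ : ∃ m, 2 * k = m + 1 := ⟨2 * k - 1, by omega⟩
  rw [wF, wF, hm, Nat.add_sub_cancel, Nat.choose_succ_succ']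
  push_cast
  ring

theorem wF_succ_succ (hB : ∀ n ≤ 2 * k, ((2 * k).choose n : K) ≠ 0) {j : ℕ} (hj : j < 2 * k) :
    wF K k (j + 2) =
      (1 - chooseRatio K k (j + 1)) * wF K k (j + 1) + chooseRatio K k (j + 1) * wF K k j := by
  have h1 := wF_succ_sub (K := K) (k := k) j (by omega)
  have h2 := wF_succ_sub (K := K) (k := k) (j + 1) (by omega)
  have h3 : chooseRatio K k (j + 1) * ((2 * k).choose (j + 1) : K) = (2 * k).choose (j + 2) :=
    div_mul_cancel₀ _ (hB _ hj)
  rw [← h3] at h2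
  linear_combination h2 + chooseRatio K k (j + 1) * h1

theorem wF_zero : wF K k 0 = 1 := by simp [wF]

theorem wF_one (hk : 1 ≤ k) : wF K k 1 = 1 - 2 * (k : K) := by
  have := wF_succ_sub (K := K) 0 hk
  simp [wF_zero] at this
  linear_combination this

theorem wF_pred_top (hk : 1 ≤ k) : wF K k (2 * k - 1) = -1 := by
  have : Odd (2 * k - 1) := ⟨k - 1, by omega⟩
  simp [wF, this.neg_one_pow]

theorem wF_top (hk : 1 ≤ k) : wF K k (2 * k) = 0 := by
  simp [wF, Nat.choose_eq_zero_of_lt (show 2 * k - 1 < 2 * k by omega)]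

theorem chooseRatio_zero : chooseRatio K k 0 = 2 * (k : K) := by simp [chooseRatio]

theorem eval_one_geg (hB : ∀ n ≤ 2 * k, ((2 * k).choose n : K) ≠ 0) :
    ∀ n ≤ 2 * k, (geg K k (n + 1)).eval 1 = wF K k n := by
  intro n
  induction n using Nat.twoStepInduction with
  | zero => simp [geg, wF_zero]
  | one => intro h; simp [geg, wF_one (show 1 ≤ k by omega), chooseRatio_zero]
  | more n ih1 ih2 =>
    intro h
    rw [geg, wF_succ_succ hB (by omega), ← ih1 (by omega), ← ih2 (by omega)]
    simp

theorem eval_neg_one_geg (n : ℕ) :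
    (geg K k n).eval (-1) = (-1) ^ (n + 1) * (geg K k n).eval 1 := by
  induction n using Nat.twoStepInduction with
  | zero => simp [geg]
  | one => simp [geg]
  | more n ih1 ih2 => simp only [geg, eval_add, eval_mul, eval_C, eval_X, ih1, ih2]; ring

theorem X_sq_sub_one_eq : (X ^ 2 - 1 : K[X]) = (X - C 1) * (X - C (-1)) := by
  simp only [C_neg, C_1]; ring

theorem isCoprime_X_sub_C {a : K} {f : K[X]} (h : f.eval a ≠ 0) : IsCoprime (X - C a) f :=
  (irreducible_X_sub_C a).coprime_iff_not_dvd.2 fun h' => h (dvd_iff_isRoot.1 h')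

theorem X_sq_sub_one_dvd (h2 : (2 : K) ≠ 0) {f : K[X]} (h : f.eval 1 = 0) (h' : f.eval (-1) = 0) :
    X ^ 2 - 1 ∣ f := by
  rw [X_sq_sub_one_eq]
  refine IsCoprime.mul_dvd (isCoprime_X_sub_C ?_) (dvd_iff_isRoot.2 h) (dvd_iff_isRoot.2 h')
  simpa [one_add_one_eq_two] using h2

theorem monic_X_sq_sub_one_pow : ((X ^ 2 - 1 : K[X]) ^ k).Monic := by
  apply Monic.pow
  simpa using monic_X_pow_sub_C (1 : K) two_ne_zero

theorem natDegree_X_sq_sub_one_pow : ((X ^ 2 - 1 : K[X]) ^ k).natDegree = 2 * k := by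
  rw [natDegree_pow, ← C_1, natDegree_X_pow_sub_C, mul_comm]

theorem natDegree_Qpoly_lt (hk : 1 ≤ k) : (Qpoly K k).natDegree < 2 * k := by
  refine (Nat.lt_iff_le_pred (by omega)).2 (natDegree_sum_le_of_forall_le _ _ fun i hi => ?_)
  have := Finset.mem_range.1 hi
  exact (natDegree_C_mul_X_pow_le _ _).trans (by omega)

theorem div_X_sq_sub_one_pow (hk : 1 ≤ k) {f g : K[X]} {c : K}
    (h : f = (X ^ 2 - 1) ^ k * g - C c * Qpoly K k) : f / (X ^ 2 - 1) ^ k = g := by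
  rw [← divByMonic_eq_div _ monic_X_sq_sub_one_pow]
  refine (div_modByMonic_unique g (-(C c * Qpoly K k))
    monic_X_sq_sub_one_pow ⟨by rw [h]; ring, ?_⟩).1
  rw [degree_neg]
  refine degree_lt_degree ((natDegree_C_mul_le _ _).trans_lt ?_)
  rw [natDegree_X_sq_sub_one_pow]
  exact natDegree_Qpoly_lt hk

variable {p t : ℕ} [Fact p.Prime] [CharP K p]

theorem thF_pow (h2 : (2 : K) ≠ 0) : thF K k ^ p ^ t = thF K k := by
  rw [← iterateFrobenius_def, thF_eq h2]
  simp only [map_mul, map_pow, map_neg, map_one, map_inv₀, map_natCast, map_ofNat]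

theorem exists_X_pow_eq (h2 : (2 : K) ≠ 0) (hk : 1 ≤ k) (hkr : k < p ^ t)
    (hB : ∀ n ≤ 2 * k, ((2 * k).choose n : K) ≠ 0) (hκ : 2 * (k : K) * thF K k ≠ 0) :
    ∃ A : K[X], X ^ p ^ t = (X ^ 2 - 1) ^ k * A - C (2 * (k : K) * thF K k) * Qpoly K k ∧
      A.eval 1 = thF K k ∧ A.eval (-1) = -thF K k := by
  have hp2 : p ≠ 2 := by rintro rfl; exact h2 (by simpa using CharP.cast_eq_zero K 2)
  have hodd : Odd (p ^ t) := ((Fact.out : p.Prime).odd_of_ne_two hp2).pow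
  have ht : t ≠ 0 := by rintro rfl; simp at hkr; omega
  have hgt := geg_pred_top hk h2 hκ hB
  set B : K[X] := C (2 * (k : K) * thF K k) * Qpoly K k with hBdef
  have hB1 : B.eval 1 = -1 := by
    have := eval_one_geg hB (2 * k - 1) (by omega)
    rwa [wF_pred_top hk, Nat.sub_add_cancel (by omega), hgt] at this
  have hB2 : B.eval (-1) = 1 := by
    rw [← hgt, eval_neg_one_geg, hgt, hB1]
    simp [pow_succ]
  have hd1 : (X ^ 2 - 1) ^ k ∣ 1 - B * B := by
    have h := geg_top_dvd_sub hB (2 * k) 1 (by omega)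
    rw [geg_top h2 hB, hgt] at h
    exact (dvd_mul_left _ _).trans h
  have hd2 : (X ^ 2 - 1 : K[X]) ^ k ∣ (X ^ p ^ t) ^ 2 - 1 := by
    have : (X ^ p ^ t : K[X]) ^ 2 - 1 = (X ^ 2 - 1) ^ p ^ t := by
      rw [sub_pow_char_pow, one_pow, ← pow_mul, ← pow_mul, mul_comm]
    rw [this]
    exact pow_dvd_pow _ hkr.le
  have hd : (X ^ 2 - 1) ^ k ∣ (B - X ^ p ^ t) * (X ^ p ^ t + B) := by
    have : (B - X ^ p ^ t) * (X ^ p ^ t + B) = -(1 - B * B) - ((X ^ p ^ t) ^ 2 - 1) := by ring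
    rw [this]
    exact dvd_sub hd1.neg_right hd2
  have hco : IsCoprime ((X ^ 2 - 1) ^ k) (B - X ^ p ^ t) := by
    refine IsCoprime.pow_left ?_
    rw [X_sq_sub_one_eq]
    refine (isCoprime_X_sub_C ?_).mul_left (isCoprime_X_sub_C ?_)
    · simp only [eval_sub, hB1, eval_pow, eval_X, one_pow]
      intro h; exact h2 (by linear_combination -h)
    · simp only [eval_sub, hB2, eval_pow, eval_X, hodd.neg_one_pow]
      intro h; exact h2 (by linear_combination h)
  obtain ⟨A, hA⟩ := hco.dvd_of_dvd_mul_left hd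
  have hder : C (2 * (k : K) * thF K k) = C (2 * (k : K)) * X * A + (X ^ 2 - 1) * derivative A := by
    have h := congrArg derivative hA
    have hX : derivative (X ^ p ^ t : K[X]) = 0 := by
      rw [derivative_X_pow]; simp [ht]
    rw [derivative_add, hX, hBdef, derivative_C_mul, derivative_Qpoly h2 hκ hB hk, derivative_mul,
      derivative_pow, zero_add] at h
    have hne : (X ^ 2 - 1 : K[X]) ^ (k - 1) ≠ 0 := monic_X_sq_sub_one_pow.ne_zero
    refine mul_right_cancel₀ hne ?_
    rw [h]
    conv_lhs => rw [show k = k - 1 + 1 by omega]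
    simp only [pow_succ, Nat.add_sub_cancel]
    rw [Nat.sub_add_cancel hk]
    have hC2 : (C 2 : K[X]) = 2 := map_ofNat C 2
    simp [hC2]
    ring
  have hk0 : 2 * (k : K) ≠ 0 := left_ne_zero_of_mul hκ
  refine ⟨A, by rw [← hA]; ring, mul_left_cancel₀ hk0 ?_, mul_left_cancel₀ hk0 ?_⟩
  · have := congrArg (eval 1) hder
    simp only [eval_add, eval_mul, eval_C, eval_X, eval_sub, eval_pow, eval_one] at this
    linear_combination -this
  · have := congrArg (eval (-1)) hder
    simp only [eval_add, eval_mul, eval_C, eval_X, eval_sub, eval_pow, eval_one] at this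
    linear_combination this

theorem Aseq_pow (h2 : (2 : K) ≠ 0) (hk : 1 ≤ k) (hkr : k < p ^ t)
    (hB : ∀ n ≤ 2 * k, ((2 * k).choose n : K) ≠ 0) (hκ : 2 * (k : K) * thF K k ≠ 0) (i : ℕ) :
    (Aseq K (p ^ t) k (i + 1)).eval 1 = thF K k ^ i ∧
    (Aseq K (p ^ t) k (i + 1)).eval (-1) = -thF K k ^ i ∧
    Aseq K (p ^ t) k (i + 1) ^ p ^ t = (X ^ 2 - 1) ^ k * Aseq K (p ^ t) k (i + 2) -
      C (2 * (k : K) * thF K k * thF K k ^ i) * Qpoly K k := by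
  obtain ⟨A, hA, hA1, hA2⟩ := exists_X_pow_eq (p := p) (t := t) h2 hk hkr hB hκ
  have key : ∀ i, (Aseq K (p ^ t) k (i + 1)).eval 1 = thF K k ^ i →
      (Aseq K (p ^ t) k (i + 1)).eval (-1) = -thF K k ^ i →
      Aseq K (p ^ t) k (i + 1) ^ p ^ t = (X ^ 2 - 1) ^ k * Aseq K (p ^ t) k (i + 2) -
        C (2 * (k : K) * thF K k * thF K k ^ i) * Qpoly K k ∧
      (Aseq K (p ^ t) k (i + 2)).eval 1 = thF K k ^ (i + 1) ∧
      (Aseq K (p ^ t) k (i + 2)).eval (-1) = -thF K k ^ (i + 1) := by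
    intro i e1 e2
    obtain ⟨G, hG⟩ := X_sq_sub_one_dvd (f := Aseq K (p ^ t) k (i + 1) - C (thF K k ^ i) * X) h2
      (by simp [e1]) (by simp [e2])
    have hpow : Aseq K (p ^ t) k (i + 1) ^ p ^ t =
        (X ^ 2 - 1) ^ k * (C (thF K k ^ i) * A + (X ^ 2 - 1) ^ (p ^ t - k) * G ^ p ^ t) -
          C (2 * (k : K) * thF K k * thF K k ^ i) * Qpoly K k := by
      rw [eq_add_of_sub_eq hG, add_pow_char_pow, mul_pow, mul_pow, hA, ← C_pow, ← pow_mul,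
        mul_comm i, pow_mul, thF_pow h2]
      conv_lhs => rw [show p ^ t = k + (p ^ t - k) by omega, pow_add]
      rw [show k + (p ^ t - k) = p ^ t by omega]
      simp only [C_mul]
      ring
    have hdiv := div_X_sq_sub_one_pow hk hpow
    have hs : p ^ t - k ≠ 0 := by omega
    rw [Aseq, hdiv]
    refine ⟨hpow, ?_, ?_⟩
    · simp [hA1, hs, pow_succ]
    · simp [hA2, hs, pow_succ]
  have all : ∀ i, (Aseq K (p ^ t) k (i + 1)).eval 1 = thF K k ^ i ∧
      (Aseq K (p ^ t) k (i + 1)).eval (-1) = -thF K k ^ i := by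
    intro i
    induction i with
    | zero => simp [Aseq]
    | succ i ih => exact (key i ih.1 ih.2).2
  exact ⟨(all i).1, (all i).2, (key i (all i).1 (all i).2).1⟩

theorem one_le_natDegree_Aseq (h2 : (2 : K) ≠ 0) (hk : 1 ≤ k) (hkr : k < p ^ t)
    (hB : ∀ n ≤ 2 * k, ((2 * k).choose n : K) ≠ 0) (hκ : 2 * (k : K) * thF K k ≠ 0) (i : ℕ) :
    1 ≤ (Aseq K (p ^ t) k (i + 1)).natDegree := by
  obtain ⟨e1, e2, -⟩ := Aseq_pow (p := p) (t := t) h2 hk hkr hB hκ i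
  by_contra h
  obtain ⟨c, hc⟩ := natDegree_eq_zero.1 (by omega : (Aseq K (p ^ t) k (i + 1)).natDegree = 0)
  rw [← hc, eval_C] at e1 e2
  exact mul_ne_zero h2 (pow_ne_zero i (right_ne_zero_of_mul hκ)) (by linear_combination -e1 + e2)

end PartialQuotients

section Index
variable {k l n : ℕ}

theorem fIdx_eq (k l n : ℕ) : fIdx k l (n + 1) = (2 * k + 1) * n + l + 1 := by
  rw [fIdx, mul_add]; omega

theorem lt_fIdx (hl : 1 ≤ l) (hn : 1 ≤ n) : n < fIdx k l n := by
  obtain ⟨n, rfl⟩ := Nat.exists_eq_add_of_le' hn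
  rw [fIdx_eq]
  nlinarith [Nat.zero_le (k * n)]

theorem fIdx_succ (hn : 1 ≤ n) : fIdx k l (n + 1) = fIdx k l n + 2 * k + 1 := by
  obtain ⟨n, rfl⟩ := Nat.exists_eq_add_of_le' hn
  rw [fIdx_eq, fIdx_eq]; ring

theorem fIdx_add_div {j : ℕ} (hn : 1 ≤ n) (hj : j ≤ 2 * k) :
    (fIdx k l n + j + 2 * k - l) / (2 * k + 1) = n := by
  obtain ⟨n, rfl⟩ := Nat.exists_eq_add_of_le' hn
  rw [fIdx_eq, show (2 * k + 1) * n + l + 1 + j + 2 * k - l = j + (2 * k + 1) * (n + 1) by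
    rw [mul_add]; omega, Nat.add_mul_div_left _ _ (by omega), Nat.div_eq_of_lt (by omega), zero_add]

theorem iIdx_of_le (hn : n ≤ l) : iIdx k l n = 1 := by
  rw [iIdx, dif_neg]
  rw [Nat.div_eq_of_lt (by omega)]
  simp

theorem iIdx_fIdx (hl : 1 ≤ l) (hn : 1 ≤ n) : iIdx k l (fIdx k l n) = iIdx k l n + 1 := by
  have := fIdx_add_div (k := k) (l := l) hn (Nat.zero_le _)
  rw [add_zero] at this
  rw [iIdx, dif_pos, this]
  rw [this]
  exact ⟨hn, rfl, lt_fIdx hl hn⟩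

theorem iIdx_fIdx_add {j : ℕ} (hn : 1 ≤ n) (hj1 : 1 ≤ j) (hj : j ≤ 2 * k) :
    iIdx k l (fIdx k l n + j) = 1 := by
  rw [iIdx, dif_neg]
  rw [fIdx_add_div hn hj]
  omega

theorem one_le_iIdx (k l n : ℕ) : 1 ≤ iIdx k l n := by
  rw [iIdx]; split_ifs <;> omega

end Index

section ContinuedFraction
variable {L : Type*} [Field L]

theorem cnum_cden_shift (a : ℕ → L) (n : ℕ) :
    cnum a (n + 1) = a 1 * cnum (fun j => a (j + 1)) n + cden (fun j => a (j + 1)) n ∧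
      cden a (n + 1) = cnum (fun j => a (j + 1)) n := by
  induction n using Nat.twoStepInduction with
  | zero => simp [cnum, cden]
  | one => simp [cnum, cden, mul_comm]
  | more n ih1 ih2 =>
    refine ⟨?_, ?_⟩
    · rw [cnum, ih1.1, ih2.1, cnum, cden]; ring
    · rw [cden, ih1.2, ih2.2, cnum]

theorem cnum_cden_congr {a b : ℕ → L} {l : ℕ} (h : ∀ n, 1 ≤ n → n ≤ l → a n = b n) :
    ∀ n ≤ l, cnum a n = cnum b n ∧ cden a n = cden b n := by
  intro n
  induction n using Nat.twoStepInduction with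
  | zero => simp [cnum, cden]
  | one => intro hn; simp [cnum, cden, h 1 le_rfl hn]
  | more n ih1 ih2 =>
    intro hn
    obtain ⟨e1, e2⟩ := ih1 (by omega)
    obtain ⟨e3, e4⟩ := ih2 (by omega)
    simp only [cnum, cden, e1, e2, e3, e4, h (n + 2) (by omega) hn, and_self]

variable {Γ₀ : Type*} [LinearOrderedCommGroupWithZero Γ₀] [Valued L Γ₀]

theorem valuation_eq_of_tendsto {u : ℕ → L} {x : L} {c : Γ₀} (h : Filter.Tendsto u .atTop (nhds x))
    (hc : ∀ᶠ n in .atTop, Valued.v (u n) = c) : Valued.v x = c := by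
  obtain ⟨N, hN⟩ := Filter.eventually_atTop.1 hc
  have hcl := Valued.isClosed_sphere L (Valued.v.restrict (u N))
  have hx : x ∈ {y | Valued.v.restrict y = Valued.v.restrict (u N)} := by
    refine hcl.mem_of_tendsto h (Filter.eventually_atTop.2 ⟨N, fun n hn => ?_⟩)
    exact Valued.v.restrict_inj.2 ((hN n hn).trans (hN N le_rfl).symm)
  exact (Valued.v.restrict_inj.1 hx).trans (hN N le_rfl)

theorem valuation_cnum_succ {a : ℕ → L} (ha : ∀ n, 1 ≤ n → 1 < Valued.v (a n)) (n : ℕ) :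
    cnum a n ≠ 0 ∧ Valued.v (cnum a (n + 1)) = Valued.v (a (n + 1)) * Valued.v (cnum a n) := by
  induction n with
  | zero => simp [cnum]
  | succ n ih =>
    have hpos : 0 < Valued.v (cnum a n) := by simpa [Valuation.pos_iff] using ih.1
    have hlt : Valued.v (cnum a n) < Valued.v (cnum a (n + 1)) := by
      rw [ih.2]; exact lt_mul_of_one_lt_left hpos (ha _ (by omega))
    refine ⟨by rw [← Valuation.pos_iff (v := Valued.v)]; exact hpos.trans hlt, ?_⟩
    rw [cnum, ← map_mul]
    apply Valuation.map_add_eq_of_lt_left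
    rw [map_mul]
    exact hlt.trans (lt_mul_of_one_lt_left (hpos.trans hlt) (ha _ (by omega)))

theorem valuation_convergent {a : ℕ → L} (ha : ∀ n, 1 ≤ n → 1 < Valued.v (a n)) (n : ℕ) :
    Valued.v (cnum a (n + 1) / cden a (n + 1)) = Valued.v (a 1) := by
  have ha' : ∀ n, 1 ≤ n → 1 < Valued.v (a (n + 1)) := fun n _ => ha _ (by omega)
  have key : Valued.v (cnum a (n + 1)) =
      Valued.v (a 1) * Valued.v (cnum (fun j => a (j + 1)) n) := by
    induction n with
    | zero => simp [cnum]
    | succ n ih =>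
      rw [(valuation_cnum_succ ha (n + 1)).2, ih, (valuation_cnum_succ ha' n).2, mul_left_comm]
  rw [(cnum_cden_shift a n).2, map_div₀, key, mul_div_cancel_right₀]
  exact (Valuation.ne_zero_iff _).2 (valuation_cnum_succ ha' n).1

theorem tendsto_shift [IsTopologicalDivisionRing L] {a : ℕ → L} {x : L}
    (ha : ∀ n, 1 ≤ n → 1 < Valued.v (a n))
    (h : Filter.Tendsto (fun n => cnum a n / cden a n) .atTop (nhds x)) :
    x - a 1 ≠ 0 ∧ Valued.v x = Valued.v (a 1) ∧
      Filter.Tendsto (fun n => cnum (fun j => a (j + 1)) n / cden (fun j => a (j + 1)) n) .atTop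
        (nhds (x - a 1)⁻¹) := by
  have ha' : ∀ n, 1 ≤ n → 1 < Valued.v (a (n + 1)) := fun n _ => ha _ (by omega)
  have hu : ∀ n, cnum (fun j => a (j + 1)) n / cden (fun j => a (j + 1)) n =
      (cnum a (n + 1) / cden a (n + 1) - a 1)⁻¹ := fun n => by
    obtain ⟨h1, h2⟩ := cnum_cden_shift a n
    rw [h1, h2, add_div, mul_div_cancel_right₀ _ (valuation_cnum_succ ha' n).1,
      add_sub_cancel_left, inv_div]
  have hsub := ((Filter.tendsto_add_atTop_iff_nat 1).2 h).sub_const (a 1)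
  have hne : x - a 1 ≠ 0 := by
    have := valuation_eq_of_tendsto hsub (c := (Valued.v (a 2))⁻¹)
      (Filter.eventually_atTop.2 ⟨1, fun n hn => ?_⟩)
    · rw [← Valuation.ne_zero_iff (Valued.v (R := L)), this]
      exact inv_ne_zero (zero_lt_one.trans (ha 2 (by omega))).ne'
    · obtain ⟨n, rfl⟩ := Nat.exists_eq_add_of_le' hn
      rw [← valuation_convergent ha' n, hu, map_inv₀, inv_inv]
  refine ⟨hne, valuation_eq_of_tendsto h (Filter.eventually_atTop.2 ⟨1, fun n hn => ?_⟩), ?_⟩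
  · obtain ⟨n, rfl⟩ := Nat.exists_eq_add_of_le' hn
    exact valuation_convergent ha n
  · simp only [hu]
    exact hsub.inv₀ hne

theorem exists_complete_quotients [IsTopologicalDivisionRing L] {a : ℕ → L} {x : L}
    (ha : ∀ n, 1 ≤ n → 1 < Valued.v (a n))
    (h : Filter.Tendsto (fun n => cnum a n / cden a n) .atTop (nhds x)) :
    ∃ B : ℕ → L, B 1 = x ∧ ∀ n, 1 ≤ n → Valued.v (B n) = Valued.v (a n) ∧
      B n = a n + (B (n + 1))⁻¹ := by
  let B : ℕ → L := fun n => Nat.rec x (fun n b => (b - a (n + 1))⁻¹) (n - 1)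
  have hB : ∀ n, B (n + 2) = (B (n + 1) - a (n + 1))⁻¹ := fun n => rfl
  have hlim : ∀ n, Filter.Tendsto
      (fun i => cnum (fun j => a (j + n)) i / cden (fun j => a (j + n)) i) .atTop
        (nhds (B (n + 1))) := by
    intro n
    induction n with
    | zero => exact h
    | succ n ih =>
      have := (tendsto_shift (a := fun j => a (j + n)) (fun m _ => ha _ (by omega)) ih).2.2
      simp only [add_assoc, add_comm 1] at this
      simpa only [hB, add_assoc, add_comm 1 n] using this
  refine ⟨B, rfl, fun n hn => ?_⟩
  obtain ⟨n, rfl⟩ := Nat.exists_eq_add_of_le' hn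
  have := (tendsto_shift (a := fun j => a (j + n)) (fun m _ => ha _ (by omega)) (hlim n)).2.1
  refine ⟨by rwa [add_comm 1 n] at this, ?_⟩
  rw [hB, inv_inv]; ring

theorem cden_mul_sub_cnum {a B : ℕ → L} (hB0 : ∀ n, 1 ≤ n → B n ≠ 0)
    (hB : ∀ n, 1 ≤ n → B n = a n + (B (n + 1))⁻¹) (n : ℕ) :
    cden a n * B 1 - cnum a n ≠ 0 ∧
      (cden a (n + 1) * B 1 - cnum a (n + 1)) * B (n + 2) = -(cden a n * B 1 - cnum a n) := by
  induction n with
  | zero =>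
    refine ⟨by simp [cnum, cden], ?_⟩
    have := hB0 2 (by omega)
    rw [hB 1 le_rfl]
    simp [cnum, cden, this]
  | succ n ih =>
    refine ⟨fun h => ih.1 (by rw [h, zero_mul] at ih; exact neg_eq_zero.1 ih.2.symm), ?_⟩
    have h3 := hB0 (n + 3) (by omega)
    have h2 := hB (n + 2) (by omega)
    have h4 : B (n + 2) * B (n + 3) = a (n + 2) * B (n + 3) + 1 := by
      rw [h2, add_mul, inv_mul_cancel₀ h3]
    simp only [cnum, cden]
    linear_combination (B (n + 3)) * ih.2 - (cden a (n + 1) * B 1 - cnum a (n + 1)) * h4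

end ContinuedFraction

/-- The constants `τ_j`, governing the partial quotients inside a block. -/
def tau (K : Type*) [Field K] (k : ℕ) (x : K) : ℕ → K
  | 0 => x
  | j + 1 => (tau K k x j * chooseRatio K k j)⁻¹

section Block
variable {F L Γ₀ : Type*} [Field F] [Field L] [Algebra F L] [LinearOrderedCommGroupWithZero Γ₀]
  {v : Valuation L Γ₀} {T : L} {k : ℕ}

theorem tau_ne_zero (hB : ∀ n ≤ 2 * k, ((2 * k).choose n : F) ≠ 0) {x : F} (hx : x ≠ 0) {j : ℕ}
    (hj : j ≤ 2 * k) : tau F k x j ≠ 0 := by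
  induction j with
  | zero => exact hx
  | succ j ih => exact inv_ne_zero (mul_ne_zero (ih (by omega)) (chooseRatio_ne_zero hB hj))

theorem valuation_algebraMap_le (hc : ∀ x : F, x ≠ 0 → v (algebraMap F L x) = 1) (x : F) :
    v (algebraMap F L x) ≤ 1 := by
  by_cases hx : x = 0
  · simp [hx]
  · exact (hc x hx).le

theorem valuation_aeval_le (hc : ∀ x : F, x ≠ 0 → v (algebraMap F L x) = 1) (hT : 1 < v T)
    {f : F[X]} {n : ℕ} (hf : f.natDegree ≤ n) : v (aeval T f) ≤ v T ^ n := by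
  rw [aeval_eq_sum_range]
  refine v.map_sum_le fun i hi => ?_
  rw [Algebra.smul_def, map_mul, map_pow]
  have := Finset.mem_range.1 hi
  exact (mul_le_of_le_one_left zero_le (valuation_algebraMap_le hc _)).trans
    (pow_le_pow_right₀ hT.le (by omega))

theorem valuation_aeval (hc : ∀ x : F, x ≠ 0 → v (algebraMap F L x) = 1) (hT : 1 < v T)
    {f : F[X]} (hf : 1 ≤ f.natDegree) : v (aeval T f) = v T ^ f.natDegree := by
  have h0 : f ≠ 0 := by rintro rfl; simp at hf
  conv_lhs => rw [← eraseLead_add_C_mul_X_pow f]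
  have h1 : v (aeval T (C f.leadingCoeff * X ^ f.natDegree)) = v T ^ f.natDegree := by
    simp [hc _ (leadingCoeff_ne_zero.2 h0)]
  rw [map_add, Valuation.map_add_eq_of_lt_right _ ?_, h1]
  rw [h1]
  exact (valuation_aeval_le hc hT f.eraseLead_natDegree_le).trans_lt
    (pow_lt_pow_right₀ hT (by omega))

theorem coeff_eq_zero_of_valuation_lt (hc : ∀ x : F, x ≠ 0 → v (algebraMap F L x) = 1) {x : F}
    {z w : L} (h : algebraMap F L x * z = w) (hw : v w < v z) : x = 0 := by
  by_contra hx
  rw [← h, map_mul, hc x hx, one_mul] at hw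
  exact hw.false

theorem block_step (hc : ∀ x : F, x ≠ 0 → v (algebraMap F L x) = 1) (hT : 1 < v T) (hk : 1 ≤ k)
    (h2 : (2 : F) ≠ 0) (hB : ∀ n ≤ 2 * k, ((2 * k).choose n : F) ≠ 0)
    (hκ : 2 * (k : F) * thF F k ≠ 0) {μ : ℕ → F} {b : ℕ → L} {e1 e2 ν ρ : F} {A η : L}
    (he1 : e1 ≠ 0) (hA : 1 < v A) (hη0 : η ≠ 0) (hη : v η * v T ^ (2 * k + 1) ≤ 1)
    (hb0 : b 0 = algebraMap F L (μ 0) * A + (b 1)⁻¹)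
    (hb : ∀ j, 1 ≤ j → j ≤ 2 * k →
      v (b j) = v T ∧ b j = algebraMap F L (μ j) * T + (b (j + 1))⁻¹)
    (hbl : 1 < v (b (2 * k + 1)))
    (h0 : algebraMap F L e1 * aeval T ((X ^ 2 - 1 : F[X]) ^ k) * b 0 +
        algebraMap F L e2 * aeval T (Qpoly F k) =
      algebraMap F L ν * (aeval T ((X ^ 2 - 1 : F[X]) ^ k) * A -
        algebraMap F L ρ * aeval T (Qpoly F k)) + η) :
    e1 * μ 0 = ν ∧ ρ * ν + e2 ≠ 0 ∧
    (∀ j < 2 * k, μ (j + 1) = tau F k (-(ρ * ν + e2) / (2 * k * e1)) (j + 1) *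
      (chooseRatio F k j - 1)) ∧
    η⁻¹ = algebraMap F L (-(2 * k * thF F k * thF F k *
          tau F k (-(ρ * ν + e2) / (2 * k * e1)) (2 * k)) / (ρ * ν + e2)) *
        aeval T ((X ^ 2 - 1 : F[X]) ^ k) * b (2 * k + 1) +
      algebraMap F L ((2 * k * thF F k) ^ 2 / (ρ * ν + e2)) * aeval T (Qpoly F k) := by
  set P := aeval T ((X ^ 2 - 1 : F[X]) ^ k) with hP
  set Q := aeval T (Qpoly F k) with hQ
  set c := algebraMap F L with hcdef
  have hT0 : 0 < v T := zero_lt_one.trans hT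
  have hvP : v P = v T ^ (2 * k) := by
    rw [hP, valuation_aeval hc hT, natDegree_X_sq_sub_one_pow]
    rw [natDegree_X_sq_sub_one_pow]; omega
  have hvQ : v Q ≤ v T ^ (2 * k - 1) :=
    valuation_aeval_le hc hT (Nat.le_sub_one_of_lt (natDegree_Qpoly_lt hk))
  have hvQ' : v Q < v P := by
    rw [hvP]; exact hvQ.trans_lt (pow_lt_pow_right₀ hT (by omega))
  have hP0 : P ≠ 0 := by
    rw [← v.ne_zero_iff, hvP]; exact (pow_pos hT0 _).ne'
  have hvη : v η < 1 := by
    by_contra! h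
    have := lt_of_lt_of_le (one_lt_pow₀ hT (by omega : 2 * k + 1 ≠ 0))
      (le_mul_of_one_le_left zero_le h)
    exact absurd hη this.not_ge
  have hvP1 : 1 < v P := by rw [hvP]; exact one_lt_pow₀ hT (by omega)
  obtain ⟨hb1v, hb1⟩ := hb 1 le_rfl (by omega)
  have hne : ∀ j, 1 ≤ j → j ≤ 2 * k + 1 → b j ≠ 0 := by
    intro j h1 h3
    rw [← v.ne_zero_iff]
    rcases Nat.lt_or_ge j (2 * k + 1) with h | h
    · rw [(hb j h1 (by omega)).1]; exact hT0.ne'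
    · obtain rfl : j = 2 * k + 1 := by omega
      exact (zero_lt_one.trans hbl).ne'
  have hgt : ∀ j, 1 ≤ j → j ≤ 2 * k + 1 → v (b j)⁻¹ < 1 := by
    intro j h1 h3
    rw [map_inv₀]
    refine inv_lt_one_of_one_lt₀ ?_
    rcases Nat.lt_or_ge j (2 * k + 1) with h | h
    · rw [(hb j h1 (by omega)).1]; exact hT
    · obtain rfl : j = 2 * k + 1 := by omega
      exact hbl
  -- comparison of the leading terms
  have hμ0 : e1 * μ 0 = ν := by
    rw [← sub_eq_zero]
    refine coeff_eq_zero_of_valuation_lt (z := P * A)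
      (w := -(c e1 * P * (b 1)⁻¹) - c (ρ * ν + e2) * Q + η) hc ?_ ?_
    · rw [hb0] at h0
      simp only [← hcdef, map_sub, map_mul, map_add]
      linear_combination h0
    · have hlt : v P < v (P * A) := by
        rw [map_mul]; exact lt_mul_of_one_lt_right (zero_lt_one.trans hvP1) hA
      refine v.map_add_lt (v.map_sub_lt ?_ ?_) (hvη.trans (hvP1.trans hlt))
      · rw [v.map_neg, map_mul, map_mul, hc _ he1, one_mul]
        exact (mul_le_of_le_one_right zero_le (hgt 1 le_rfl (by omega)).le).trans_lt hlt
      · rw [map_mul]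
        exact ((mul_le_of_le_one_left zero_le (valuation_algebraMap_le hc _)).trans_lt hvQ').trans hlt
  have hb1eq : c e1 * P = b 1 * (η - c (ρ * ν + e2) * Q) := by
    rw [hb0] at h0
    have h1 := hne 1 le_rfl (by omega)
    have h3 : b 1 * (b 1)⁻¹ = 1 := mul_inv_cancel₀ h1
    rw [← hμ0] at h0 ⊢
    simp only [map_mul, map_add] at h0 ⊢
    linear_combination b 1 * h0 - c e1 * P * h3
  have hδ : ρ * ν + e2 ≠ 0 := by
    intro h
    rw [h, map_zero, zero_mul, sub_zero] at hb1eq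
    have := congrArg v hb1eq
    rw [map_mul, map_mul, hc _ he1, one_mul, hb1v, hvP] at this
    have h3 : v T ^ (2 * k) * v T ^ (2 * k + 1) ≤ v T := by
      rw [this, mul_assoc]
      exact mul_le_of_le_one_right zero_le hη
    have h4 : v T < v T ^ (2 * k) * v T ^ (2 * k + 1) := by
      rw [← pow_add]
      simpa using pow_lt_pow_right₀ hT (by omega : 1 < 2 * k + (2 * k + 1))
    exact h4.not_ge h3
  refine ⟨hμ0, hδ, ?_⟩
  set δ := ρ * ν + e2 with hδdef
  have hk0 : 2 * (k : F) ≠ 0 := left_ne_zero_of_mul hκ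
  have hθ : thF F k ≠ 0 := right_ne_zero_of_mul hκ
  set κ := 2 * (k : F) * thF F k with hκdef
  set τ := tau F k (-δ / (2 * k * e1)) with hτ
  have hx0 : -δ / (2 * k * e1) ≠ 0 := div_ne_zero (neg_ne_zero.2 hδ) (mul_ne_zero hk0 he1)
  set ξ := -(c δ⁻¹ * η) with hξ
  have hvξ : v ξ = v η := by
    rw [hξ, v.map_neg, map_mul, hc _ (inv_ne_zero hδ), one_mul]
  have hξ0 : ξ ≠ 0 := by rw [← v.ne_zero_iff, hvξ]; exact v.ne_zero_iff.2 hη0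
  set y : ℕ → L := fun j => c κ⁻¹ * aeval T (geg F k (2 * k + 1 - j)) + aeval T (geg F k j) * ξ
    with hy
  have hrec : ∀ j, j < 2 * k →
      y (j + 2) = c (1 - chooseRatio F k j) * T * y (j + 1) + c (chooseRatio F k j) * y j := by
    intro j hj
    obtain ⟨i, hi⟩ : ∃ i, j + i + 1 = 2 * k := ⟨2 * k - 1 - j, by omega⟩
    simp only [hy]
    rw [show 2 * k + 1 - (j + 2) = i by omega, show 2 * k + 1 - (j + 1) = i + 1 by omega,
      show 2 * k + 1 - j = i + 2 by omega, geg_eq_of_add_eq hB hi, geg_add_two j]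
    simp only [map_add, map_mul, aeval_C, aeval_X, ← hcdef]
    ring
  have hy0 : y 0 = c (2 * k)⁻¹ * P := by
    simp only [hy, Nat.sub_zero, geg_top h2 hB]
    rw [geg, map_zero, zero_mul, add_zero, map_mul, aeval_C, ← hP, ← mul_assoc, ← map_mul]
    congr 2
    rw [hκdef]; field_simp
  have hy1 : y 1 = Q + ξ := by
    simp only [hy, Nat.add_sub_cancel, geg_pred_top hk h2 hκ hB]
    rw [geg, map_one, one_mul, map_mul, aeval_C, ← hQ, ← mul_assoc, ← map_mul,
      inv_mul_cancel₀ hκ, map_one, one_mul]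
  have hyle : ∀ j, j ≤ 2 * k → v (y j) ≤ v T ^ (2 * k - j) := by
    intro j hj
    refine v.map_add_le ?_ ?_
    · rw [map_mul, hc _ (inv_ne_zero hκ), one_mul, show 2 * k + 1 - j = 2 * k - j + 1 by omega]
      exact valuation_aeval_le hc hT (natDegree_geg_le _)
    · rw [map_mul, hvξ, mul_comm]
      rcases j with _ | j
      · simp [geg]
      · refine ((mul_le_mul_right (valuation_aeval_le hc hT ((natDegree_geg_le j).trans
          (by omega : j ≤ 2 * k + 1))) _).trans hη).trans (one_le_pow₀ hT.le)
  have hylast : v (y (2 * k + 1)) < v T := by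
    simp only [hy, Nat.sub_self, geg_top h2 hB]
    rw [geg, map_zero, mul_zero, zero_add, map_mul, map_mul, aeval_C, ← hP, map_mul, hc _ hθ,
      one_mul, hvP,
      hvξ]
    refine lt_of_le_of_lt ?_ hT
    refine le_trans ?_ hη
    rw [mul_comm]
    exact mul_le_mul_right (pow_le_pow_right₀ hT.le (by omega)) _
  have main : ∀ j, j ≤ 2 * k → b (j + 1) * y (j + 1) * c (τ j) = y j ∧
      v (y j) = v T ^ (2 * k - j) ∧
      ∀ i < j, μ (i + 1) = τ (i + 1) * (chooseRatio F k i - 1) := by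
    intro j
    induction j with
    | zero =>
      intro _
      refine ⟨?_, ?_, by simp⟩
      · have h4 : c δ * ξ = -η := by
          rw [hξ, mul_neg, ← mul_assoc, ← map_mul, mul_inv_cancel₀ hδ, map_one, one_mul]
        have h5 : y 0 * c (2 * k) * c e1 = c e1 * P := by
          rw [hy0, mul_right_comm (c _), ← map_mul, inv_mul_cancel₀ hk0, map_one]; ring
        have h6 : c (τ 0) * (c (2 * k) * c e1) = -c δ := by
          rw [← map_mul, ← map_mul, ← map_neg]
          congr 1
          simp only [hτ, tau]
          exact div_mul_cancel₀ _ (mul_ne_zero hk0 he1)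
        have h7 : c (2 * k) * c e1 ≠ 0 := by
          rw [← map_mul]; exact (_root_.map_ne_zero _).2 (mul_ne_zero hk0 he1)
        refine mul_right_cancel₀ h7 ?_
        rw [zero_add, hy1]
        linear_combination b 1 * (Q + ξ) * h6 - h5 - hb1eq - b 1 * h4
      · rw [hy0, map_mul, hc _ (inv_ne_zero hk0), one_mul, hvP, Nat.sub_zero]
    | succ j ih =>
      intro hj
      obtain ⟨i1, i2, i3⟩ := ih (by omega)
      obtain ⟨hbv, hbj⟩ := hb (j + 1) (by omega) hj
      have hτ0 : τ j ≠ 0 := tau_ne_zero hB hx0 (by omega)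
      have hr0 : chooseRatio F k j ≠ 0 := chooseRatio_ne_zero hB (by omega)
      have hv1 : v (y (j + 1)) = v T ^ (2 * k - (j + 1)) := by
        have := congrArg v i1
        rw [map_mul, map_mul, hc _ hτ0, mul_one, hbv, i2,
          show 2 * k - j = 2 * k - (j + 1) + 1 by omega, pow_succ'] at this
        exact mul_left_cancel₀ hT0.ne' this
      have hvlt : v (y (j + 2)) < v (T * y (j + 1)) := by
        rw [map_mul, hv1]
        rcases Nat.lt_or_ge (j + 1) (2 * k) with h | h
        · rw [← pow_succ']
          exact (hyle (j + 2) (by omega)).trans_lt (pow_lt_pow_right₀ hT (by omega))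
        · rw [show j + 2 = 2 * k + 1 by omega, show 2 * k - (j + 1) = 0 by omega, pow_zero, mul_one]
          exact hylast
      have hτ1 : τ (j + 1) * τ j * chooseRatio F k j = 1 := by
        rw [mul_assoc]; exact inv_mul_cancel₀ (mul_ne_zero hτ0 hr0)
      have hcτ : c (τ (j + 1)) * c (τ j) * c (chooseRatio F k j) = 1 := by
        rw [← map_mul, ← map_mul, hτ1, map_one]
      have heq : b (j + 1) * y (j + 1) =
          c (τ (j + 1)) * (y (j + 2) + c (chooseRatio F k j - 1) * T * y (j + 1)) := by
        rw [hrec j (by omega), ← i1]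
        simp only [map_sub, map_one]
        linear_combination (-(b (j + 1) * y (j + 1))) * hcτ
      have hμ : μ (j + 1) = τ (j + 1) * (chooseRatio F k j - 1) := by
        rw [← sub_eq_zero]
        refine coeff_eq_zero_of_valuation_lt (z := T * y (j + 1))
          (w := c (τ (j + 1)) * y (j + 2) - (b (j + 2))⁻¹ * y (j + 1)) hc ?_ ?_
        · rw [hbj] at heq
          simp only [← hcdef, map_sub, map_mul, map_one] at heq ⊢
          linear_combination heq
        · refine v.map_sub_lt ?_ ?_
          · rw [map_mul]
            exact (mul_le_of_le_one_left zero_le (valuation_algebraMap_le hc _)).trans_lt hvlt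
          · rw [map_mul, map_mul, mul_comm, mul_comm (v T)]
            refine mul_lt_mul_of_pos_left ((hgt (j + 2) (by omega) (by omega)).trans hT) ?_
            rw [hv1]; exact pow_pos hT0 _
      refine ⟨?_, hv1, fun i hi => ?_⟩
      · have h8 := hne (j + 2) (by omega) (by omega)
        have h9 : b (j + 2) * (b (j + 2))⁻¹ = 1 := mul_inv_cancel₀ h8
        rw [hbj, hμ] at heq
        simp only [map_sub, map_mul, map_one] at heq
        linear_combination y (j + 1) * h9 - b (j + 2) * heq
      · rcases Nat.lt_succ_iff_lt_or_eq.1 hi with h | rfl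
        · exact i3 i h
        · exact hμ
  obtain ⟨m1, -, m3⟩ := main (2 * k) le_rfl
  refine ⟨m3, ?_⟩
  have hyl : y (2 * k + 1) = c (thF F k) * P * ξ := by
    simp only [hy, Nat.sub_self, geg_top h2 hB]
    rw [geg, map_zero, mul_zero, zero_add, map_mul, aeval_C]
  have hyp : y (2 * k) = c κ⁻¹ + c κ * Q * ξ := by
    simp only [hy, show 2 * k + 1 - 2 * k = 1 by omega, geg_pred_top hk h2 hκ hB]
    rw [geg, map_one, mul_one, map_mul, aeval_C]
  rw [hyl, hyp, hξ] at m1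
  have e1' : c κ * c κ⁻¹ = 1 := by rw [← map_mul, mul_inv_cancel₀ hκ, map_one]
  have e2' : η * η⁻¹ = 1 := mul_inv_cancel₀ hη0
  rw [div_eq_mul_inv, div_eq_mul_inv]
  simp only [map_mul, map_neg, map_pow] at m1 ⊢
  linear_combination (-(c κ * η⁻¹)) * m1 - η⁻¹ * e1' +
    (c κ ^ 2 * Q * c δ⁻¹ - c κ * c (thF F k) * c (τ (2 * k)) * P * b (2 * k + 1) * c δ⁻¹) * e2'

end Block

section Laurent
variable {F : Type*} [Field F]

theorem one_lt_valuation_Tvar : 1 < Valued.v (Tvar F) := by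
  rw [Tvar, LaurentSeries.valuation_single_zpow, ← WithZero.exp_zero, WithZero.exp_lt_exp]
  norm_num

theorem valuation_algebraMap (x : F) (hx : x ≠ 0) :
    Valued.v (algebraMap F (LaurentSeries F) x) = 1 := by
  have hle : ∀ y : F, Valued.v (algebraMap F (LaurentSeries F) y) ≤ 1 := fun y => by
    rw [LaurentSeries.val_le_one_iff_eq_coe]
    exact ⟨algebraMap F (PowerSeries F) y, rfl⟩
  refine le_antisymm (hle x) ?_
  have h := hle x⁻¹
  rw [map_inv₀, map_inv₀] at h
  exact (inv_le_one₀ ((Valuation.pos_iff _).2 ((_root_.map_ne_zero _).2 hx))).1 h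

theorem PkLS_eq (k : ℕ) : PkLS F k = aeval (Tvar F) ((X ^ 2 - 1 : F[X]) ^ k) := by simp [PkLS]

theorem QkLS_eq (k : ℕ) : QkLS F k = aeval (Tvar F) (Qpoly F k) := by simp [QkLS, Qpoly]

end Laurent

/-- The constants `(ε₁, ε₂)` of the equation satisfied by the `(n + 1)`-st complete quotient. -/
def epsPair (F : Type*) [Field F] (k l r : ℕ) (lam : ℕ → F) (e1 e2 : F) : ℕ → F × F
  | 0 => (e1, e2)
  | n + 1 =>
    let e := epsPair F k l r lam e1 e2 n
    let δ := 2 * k * thF F k * thF F k ^ (iIdx k l (n + 1) - 1) * lam (n + 1) ^ r + e.2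
    (-(2 * k * thF F k * thF F k * tau F k (-δ / (2 * k * e.1)) (2 * k)) / δ,
      (2 * k * thF F k) ^ 2 / δ)

/-- The relations between the `λ_n` forced by a perfect expansion. -/
structure PerfectRelations (F : Type*) [Field F] (k l r : ℕ) (lam : ℕ → F) (e1 e2 : F)
    (δ E e : ℕ → F) : Prop where
  E_one : E 1 = e1
  e_one : e 1 = e2
  δ_eq : ∀ n, 1 ≤ n →
    δ n = 2 * k * thF F k * thF F k ^ (iIdx k l n - 1) * lam n ^ r + e n
  δ_ne_zero : ∀ n, 1 ≤ n → δ n ≠ 0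
  E_ne_zero : ∀ n, 1 ≤ n → E n ≠ 0
  e_succ : ∀ n, 1 ≤ n → e (n + 1) = (2 * k * thF F k) ^ 2 / δ n
  E_succ : ∀ n, 1 ≤ n → E (n + 1) =
    -(2 * k * thF F k * thF F k * tau F k (-δ n / (2 * k * E n)) (2 * k)) / δ n
  lam_fIdx : ∀ n, 1 ≤ n → E n * lam (fIdx k l n) = lam n ^ r
  lam_fIdx_add : ∀ n, 1 ≤ n → ∀ j < 2 * k, lam (fIdx k l n + (j + 1)) =
    tau F k (-δ n / (2 * k * E n)) (j + 1) * (chooseRatio F k j - 1)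

section Perfect
variable {F : Type*} [Field F] {p t k l : ℕ} [Fact p.Prime] [CharP F p]

theorem perfectRelations (h2 : (2 : F) ≠ 0) (hk : 1 ≤ k) (hkr : 2 * k + 1 ≤ p ^ t)
    (hB : ∀ n ≤ 2 * k, ((2 * k).choose n : F) ≠ 0) (hκ : 2 * (k : F) * thF F k ≠ 0) (hl : 1 ≤ l)
    {e1 e2 : F} (he1 : e1 ≠ 0) {lam : ℕ → F} (hlam : ∀ n, 1 ≤ n → lam n ≠ 0)
    {α : LaurentSeries F} (heqn : CFtypeEqn F (p ^ t) k l lam e1 e2 α)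
    (hconv : ConvergesTo F (aPQ F (p ^ t) k l lam) α) :
    ∃ δ E e : ℕ → F, PerfectRelations F k l (p ^ t) lam e1 e2 δ E e := by
  have hT := one_lt_valuation_Tvar (F := F)
  have hc := valuation_algebraMap (F := F)
  have hT0 : 0 < Valued.v (Tvar F) := zero_lt_one.trans hT
  have hkr' : k < p ^ t := by omega
  have : CharP (LaurentSeries F) p :=
    charP_of_injective_algebraMap (algebraMap F (LaurentSeries F)).injective p
  set a := aPQ F (p ^ t) k l lam with ha_def
  have hA : ∀ i, 1 ≤ i → Valued.v (Tvar F) ≤ Valued.v (polyT F (Aseq F (p ^ t) k i)) := by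
    intro i hi
    obtain ⟨i, rfl⟩ := Nat.exists_eq_add_of_le' hi
    have hd := one_le_natDegree_Aseq (p := p) (t := t) h2 hk hkr' hB hκ i
    rw [polyT, valuation_aeval hc hT hd]
    exact le_self_pow₀ hT.le (by omega)
  have hva : ∀ n, 1 ≤ n → Valued.v (a n) = Valued.v (polyT F (Aseq F (p ^ t) k (iIdx k l n))) := by
    intro n hn
    rw [ha_def, aPQ, map_mul, hc _ (hlam n hn), one_mul]
  have hvT : ∀ n, 1 ≤ n → Valued.v (Tvar F) ≤ Valued.v (a n) := fun n hn => by
    rw [hva n hn]; exact hA _ (one_le_iIdx k l n)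
  have hlin : ∀ n, iIdx k l n = 1 → a n = aLin F lam n := by
    intro n hn
    simp [ha_def, aPQ, aLin, hn, Aseq, polyT]
  obtain ⟨B, hB1, hBn⟩ := exists_complete_quotients (fun n hn => hT.trans_le (hvT n hn)) hconv
  have hB0 : ∀ n, 1 ≤ n → B n ≠ 0 := fun n hn => by
    rw [← Valuation.ne_zero_iff (Valued.v (R := LaurentSeries F)), (hBn n hn).1]
    exact (hT0.trans_le (hvT n hn)).ne'
  set P := aeval (Tvar F) ((X ^ 2 - 1 : F[X]) ^ k) with hP
  set Q := aeval (Tvar F) (Qpoly F k) with hQ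
  set c := algebraMap F (LaurentSeries F) with hcdef
  set κ := 2 * (k : F) * thF F k with hκdef
  have hbase : B 1 ^ p ^ t = c e1 * P * B (l + 1) + c e2 * Q := by
    rw [hB1]
    have hcongr := cnum_cden_congr (a := a) (b := aLin F lam) (l := l)
      (fun n h1 hn => hlin n (iIdx_of_le hn))
    rw [CFtypeEqn, PkLS_eq, QkLS_eq, ← (hcongr l le_rfl).1, ← (hcongr l le_rfl).2,
      ← (hcongr (l - 1) (by omega)).1, ← (hcongr (l - 1) (by omega)).2, ← hP, ← hQ, ← hcdef] at heqn
    obtain ⟨m, rfl⟩ := Nat.exists_eq_add_of_le' hl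
    rw [Nat.add_sub_cancel] at heqn
    have hD := cden_mul_sub_cnum hB0 (fun n hn => (hBn n hn).2)
    have h1 := (hD m).2
    have h3 := (hD (m + 1)).1
    rw [hB1] at h1 h3
    refine mul_left_cancel₀ h3 ?_
    linear_combination heqn - c e1 * P * h1
  set ep := epsPair F k l (p ^ t) lam e1 e2 with hep
  set E : ℕ → F := fun n => (ep (n - 1)).1 with hE
  set e : ℕ → F := fun n => (ep (n - 1)).2 with he
  set δ : ℕ → F := fun n => κ * thF F k ^ (iIdx k l n - 1) * lam n ^ p ^ t + e n with hδ
  have he_succ : ∀ n, 1 ≤ n → e (n + 1) = κ ^ 2 / δ n := by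
    intro n hn
    obtain ⟨n, rfl⟩ := Nat.exists_eq_add_of_le' hn
    rfl
  have hE_succ : ∀ n, 1 ≤ n → E (n + 1) =
      -(κ * thF F k * tau F k (-δ n / (2 * k * E n)) (2 * k)) / δ n := by
    intro n hn
    obtain ⟨n, rfl⟩ := Nat.exists_eq_add_of_le' hn
    rfl
  have hstep : ∀ n, 1 ≤ n → E n ≠ 0 →
      B n ^ p ^ t = c (E n) * P * B (fIdx k l n) + c (e n) * Q →
      E n * lam (fIdx k l n) = lam n ^ p ^ t ∧ δ n ≠ 0 ∧
      (∀ j < 2 * k, lam (fIdx k l n + (j + 1)) =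
        tau F k (-δ n / (2 * k * E n)) (j + 1) * (chooseRatio F k j - 1)) ∧
      B (n + 1) ^ p ^ t = c (E (n + 1)) * P * B (fIdx k l (n + 1)) + c (e (n + 1)) * Q := by
    intro n hn hEn hBr
    have hf1 : 1 ≤ fIdx k l n := hn.trans (lt_fIdx hl hn).le
    obtain ⟨i, hi⟩ : ∃ i, iIdx k l n = i + 1 := ⟨_, (Nat.sub_add_cancel (one_le_iIdx k l n)).symm⟩
    have hAp := (Aseq_pow (p := p) (t := t) h2 hk hkr' hB hκ i).2.2
    rw [← hκdef] at hAp
    have hvB := (hBn (n + 1) (by omega)).1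
    have hη0 : (B (n + 1))⁻¹ ^ p ^ t ≠ 0 := pow_ne_zero _ (inv_ne_zero (hB0 _ (by omega)))
    have hvη : Valued.v ((B (n + 1))⁻¹ ^ p ^ t) * Valued.v (Tvar F) ^ (2 * k + 1) ≤ 1 := by
      have h1 : Valued.v (Tvar F) ≤ Valued.v (B (n + 1)) := by rw [hvB]; exact hvT _ (by omega)
      rw [map_pow, map_inv₀, inv_pow]
      refine inv_mul_le_one_of_le₀ ?_ zero_le
      exact (pow_le_pow_right₀ hT.le hkr).trans (pow_le_pow_left₀ zero_le h1 _)
    have h := block_step (v := Valued.v) (T := Tvar F) (μ := fun j => lam (fIdx k l n + j))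
      (b := fun j => B (fIdx k l n + j)) (e1 := E n) (e2 := e n) (ν := lam n ^ p ^ t)
      (ρ := κ * thF F k ^ i) (A := polyT F (Aseq F (p ^ t) k (i + 2)))
      (η := (B (n + 1))⁻¹ ^ p ^ t) hc hT hk h2 hB hκ hEn
      (hT.trans_le (hA _ (by omega))) hη0 hvη ?_ ?_ ?_ ?_
    · have hδn : κ * thF F k ^ i * lam n ^ p ^ t + e n = δ n := by
        simp only [hδ, hi, Nat.add_sub_cancel]
      rw [hδn] at h
      refine ⟨h.1, h.2.1, h.2.2.1, ?_⟩
      have h4 := h.2.2.2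
      rw [inv_pow, inv_inv] at h4
      rw [h4, he_succ n hn, hE_succ n hn, fIdx_succ hn, add_assoc]
    · have := (hBn _ hf1).2
      simp only [add_zero]
      rw [this, ha_def, aPQ, iIdx_fIdx hl hn, hi]
    · intro j hj1 hj
      have h3 := hBn (fIdx k l n + j) (by omega)
      have h4 := hlin _ (iIdx_fIdx_add (k := k) (l := l) hn hj1 hj)
      refine ⟨?_, by rw [h3.2, h4, aLin]; rfl⟩
      rw [h3.1, h4, aLin, map_mul, hc _ (hlam _ (by omega)), one_mul]
    · rw [(hBn _ (by omega)).1]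
      exact hT.trans_le (hvT _ (by omega))
    · simp only [add_zero]
      rw [← hBr, (hBn n hn).2, add_pow_char_pow, ha_def, aPQ, hi, mul_pow, polyT, ← map_pow, ← map_pow,
        hAp]
      simp only [map_sub, map_mul, aeval_C, map_pow, polyT, ← hcdef]
  have hall : ∀ n, 1 ≤ n → E n ≠ 0 ∧
      B n ^ p ^ t = c (E n) * P * B (fIdx k l n) + c (e n) * Q := by
    intro n hn
    induction n, hn using Nat.le_induction with
    | base =>
      refine ⟨he1, ?_⟩
      rw [show fIdx k l 1 = l + 1 by rw [fIdx]; omega]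
      exact hbase
    | succ n hn ih =>
      obtain ⟨-, h1, -, h3⟩ := hstep n hn ih.1 ih.2
      refine ⟨?_, h3⟩
      rw [hE_succ n hn]
      have hx : -δ n / (2 * k * E n) ≠ 0 :=
        div_ne_zero (neg_ne_zero.2 h1) (mul_ne_zero (left_ne_zero_of_mul hκ) ih.1)
      exact div_ne_zero (neg_ne_zero.2 (mul_ne_zero (mul_ne_zero hκ (right_ne_zero_of_mul hκ))
        (tau_ne_zero hB hx le_rfl))) h1
  refine ⟨δ, E, e, rfl, rfl, fun n _ => rfl, ?_, fun n hn => (hall n hn).1, he_succ, hE_succ, ?_, ?_⟩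
  · exact fun n hn => (hstep n hn (hall n hn).1 (hall n hn).2).2.1
  · exact fun n hn => (hstep n hn (hall n hn).1 (hall n hn).2).1
  · exact fun n hn => (hstep n hn (hall n hn).1 (hall n hn).2).2.2.1

end Perfect

/-- The sequence `0, w_0, w_1, …`. -/
def wShift (K : Type*) [Field K] (k : ℕ) : ℕ → K
  | 0 => 0
  | j + 1 => wF K k j

section Gamma
variable {F : Type*} [Field F] {k l r : ℕ}

theorem wShift_add_two (hk : 1 ≤ k) (hB : ∀ n ≤ 2 * k, ((2 * k).choose n : F) ≠ 0) :
    ∀ j < 2 * k, wShift F k (j + 2) =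
      (1 - chooseRatio F k j) * wShift F k (j + 1) + chooseRatio F k j * wShift F k j
  | 0, _ => by simp [wShift, wF_one hk, wF_zero, chooseRatio_zero]
  | j + 1, hj => by simpa [wShift] using wF_succ_succ hB (show j < 2 * k by omega)

theorem hF_eq (hk : 1 ≤ k) (hθ : thF F k ≠ 0) {j : ℕ} (hj : j ≤ 2 * k) (x : F) :
    hF F k j x = (-1) ^ j * (2 * k).choose j * thF F k * x /
      ((thF F k + wShift F k (j + 1) * x) * (thF F k + wShift F k j * x)) := by
  rw [hF]
  split_ifs with h0 h1
  · subst h0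
    simp [wShift, wF_zero]
    field_simp
  · subst h1
    obtain ⟨m, hm⟩ : ∃ m, 2 * k = m + 1 := ⟨2 * k - 1, by omega⟩
    have h3 : wShift F k (2 * k) = -1 := by
      rw [← wF_pred_top (K := F) hk, hm]; rfl
    have h4 : wShift F k (2 * k + 1) = 0 := wF_top hk
    rw [h3, h4, Nat.choose_self, Even.neg_one_pow (even_two_mul k)]
    simp only [Nat.cast_one, one_mul, zero_mul, add_zero, neg_mul, ← sub_eq_add_neg]
    rw [mul_div_mul_left _ _ hθ, div_eq_mul_inv]
  · obtain ⟨j, rfl⟩ := Nat.exists_eq_succ_of_ne_zero h0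
    simp [wShift, div_eq_mul_inv]

theorem map_chooseRatio (φ : F →+* F) (j : ℕ) : φ (chooseRatio F k j) = chooseRatio F k j := by
  simp [chooseRatio]

variable {lam δ E e : ℕ → F} {e1 e2 : F} {φ : F →+* F}

/-- The invariant that determines the `δ_m` with `f(n) ≤ m ≤ f(n) + 2k`. -/
def BlockRelation (F : Type*) [Field F] (k l : ℕ) (φ : F →+* F) (δ E e : ℕ → F)
    (n : ℕ) (x : F) : Prop :=
  x * φ (δ n) =
    thF F k * (2 * k * (2 * k * thF F k) * φ (E n) / δ (fIdx k l n - 1) - φ (e n))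

theorem PerfectRelations.delta_fIdx (h : PerfectRelations F k l r lam e1 e2 δ E e)
    (hφ : ∀ x, φ x = x ^ r) (hφθ : φ (thF F k) = thF F k)
    (hl : 1 ≤ l) {n : ℕ} (hn : 1 ≤ n) {x : F}
    (hx : BlockRelation F k l φ δ E e n x) :
    δ (fIdx k l n) * φ (E n) = φ (δ n) * (thF F k + x) := by
  have hf := lt_fIdx (k := k) hl hn
  obtain ⟨m, hm⟩ : ∃ m, fIdx k l n = m + 1 := ⟨fIdx k l n - 1, by omega⟩
  have hm1 : 1 ≤ m := by omega
  have hδm := h.δ_ne_zero m hm1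
  have h1 := h.δ_eq (fIdx k l n) (by omega)
  have h2 : φ (δ n) = 2 * k * thF F k * thF F k ^ (iIdx k l n - 1) * φ (φ (lam n)) + φ (e n) := by
    rw [h.δ_eq n hn, ← hφ]
    simp only [map_add, map_mul, map_pow, map_natCast, map_ofNat, hφθ]
  have h3 : φ (E n) * φ (lam (fIdx k l n)) = φ (φ (lam n)) := by
    rw [← map_mul, h.lam_fIdx n hn, hφ (lam n)]
  obtain ⟨i, hi⟩ : ∃ i, iIdx k l n = i + 1 := ⟨_, (Nat.sub_add_cancel (one_le_iIdx k l n)).symm⟩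
  rw [iIdx_fIdx hl hn, hi, ← hφ, hm, h.e_succ m hm1, ← hm] at h1
  rw [hi] at h2
  rw [BlockRelation, hm] at hx
  simp only [Nat.add_sub_cancel] at h1 h2 hx
  rw [h1]
  linear_combination (2 * k * thF F k * thF F k ^ (i + 1)) * h3 - hx - thF F k * h2

theorem PerfectRelations.delta_block (h : PerfectRelations F k l r lam e1 e2 δ E e)
    (hφ : ∀ x, φ x = x ^ r) (hφθ : φ (thF F k) = thF F k) (hk : 1 ≤ k)
    (hB : ∀ n ≤ 2 * k, ((2 * k).choose n : F) ≠ 0) (hκ : 2 * (k : F) * thF F k ≠ 0)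
    (hl : 1 ≤ l) {n : ℕ} (hn : 1 ≤ n) {x : F}
    (hx : BlockRelation F k l φ δ E e n x) :
    ∀ j ≤ 2 * k, thF F k + wShift F k j * x ≠ 0 ∧ thF F k + wShift F k (j + 1) * x ≠ 0 ∧
      δ (fIdx k l n + j) = -(2 * k * thF F k * φ (tau F k (-δ n / (2 * k * E n)) j)) *
        (thF F k + wShift F k (j + 1) * x) / (thF F k + wShift F k j * x) := by
  have hf := lt_fIdx (k := k) hl hn
  have hθ := right_ne_zero_of_mul hκ
  have hk0 := left_ne_zero_of_mul hκ
  have hEn := h.E_ne_zero n hn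
  have hδn := h.δ_ne_zero n hn
  have hx0 : -δ n / (2 * k * E n) ≠ 0 :=
    div_ne_zero (neg_ne_zero.2 hδn) (mul_ne_zero hk0 hEn)
  have hnz : ∀ {a b c d : F}, a ≠ 0 → a = b * c / d → c ≠ 0 := by
    rintro a b c d ha rfl rfl
    simp at ha
  intro j
  induction j with
  | zero =>
    intro _
    have h1 : thF F k + wShift F k 0 * x = thF F k := by simp [wShift]
    have h2 : δ (fIdx k l n + 0) = -(2 * k * thF F k * φ (tau F k (-δ n / (2 * k * E n)) 0)) *
        (thF F k + wShift F k (0 + 1) * x) / (thF F k + wShift F k 0 * x) := by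
      have h3 := h.delta_fIdx hφ hφθ hl hn hx
      have h4 : φ (E n) ≠ 0 := (map_ne_zero φ).2 hEn
      have h5 := left_ne_zero_of_mul hk0
      have h6 := right_ne_zero_of_mul hk0
      rw [h1, add_zero, eq_div_iff hθ]
      simp only [tau, map_div₀, map_neg, map_mul, map_natCast, map_ofNat, wShift, wF_zero, one_mul]
      field_simp
      linear_combination h3
    exact ⟨by rwa [h1], hnz (h.δ_ne_zero _ (by omega)) h2, h2⟩
  | succ j ih =>
    intro hj
    obtain ⟨ih0, ih1, ih2⟩ := ih (by omega)
    set τ := tau F k (-δ n / (2 * k * E n)) with hτ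
    have hτ0 : φ (τ j) ≠ 0 := (map_ne_zero φ).2 (tau_ne_zero hB hx0 (by omega))
    have hq := chooseRatio_ne_zero hB (show j < 2 * k by omega)
    have hτs : φ (τ (j + 1)) = (φ (τ j) * chooseRatio F k j)⁻¹ := by
      rw [hτ, tau, map_inv₀, map_mul, map_chooseRatio]
    have hd := h.δ_eq (fIdx k l n + (j + 1)) (by omega)
    rw [iIdx_fIdx_add hn (by omega) hj, h.lam_fIdx_add n hn j (by omega), ← hφ, map_mul, map_sub,
      map_one, map_chooseRatio, ← hτ, ← add_assoc, h.e_succ _ (by omega)] at hd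
    have h2 : δ (fIdx k l n + (j + 1)) = -(2 * k * thF F k * φ (τ (j + 1))) *
        (thF F k + wShift F k (j + 1 + 1) * x) / (thF F k + wShift F k (j + 1) * x) := by
      rw [← add_assoc, hd, ih2, wShift_add_two hk hB j (by omega), hτs]
      field_simp
      ring
    exact ⟨ih1, hnz (h.δ_ne_zero _ (by omega)) h2, h2⟩

theorem PerfectRelations.delta_fIdx_add_top (h : PerfectRelations F k l r lam e1 e2 δ E e)
    (hφ : ∀ x, φ x = x ^ r) (hφθ : φ (thF F k) = thF F k) (hk : 1 ≤ k)
    (hB : ∀ n ≤ 2 * k, ((2 * k).choose n : F) ≠ 0) (hκ : 2 * (k : F) * thF F k ≠ 0)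
    (hl : 1 ≤ l) {n : ℕ} (hn : 1 ≤ n) {x : F}
    (hx : BlockRelation F k l φ δ E e n x) :
    thF F k - x ≠ 0 ∧
      δ (fIdx k l n + 2 * k) = φ (E (n + 1)) * φ (δ n) / (thF F k - x) := by
  obtain ⟨h0, h1, h2⟩ := h.delta_block hφ hφθ hk hB hκ hl hn hx (2 * k) le_rfl
  obtain ⟨m, hm⟩ : ∃ m, 2 * k = m + 1 := ⟨2 * k - 1, by omega⟩
  have h3 : wShift F k (2 * k) = -1 := by
    rw [← wF_pred_top (K := F) hk, hm]; rfl
  have h4 : wShift F k (2 * k + 1) = 0 := wF_top hk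
  rw [h3, neg_one_mul, ← sub_eq_add_neg] at h0
  rw [h3, h4, neg_one_mul, ← sub_eq_add_neg, zero_mul, add_zero] at h2
  refine ⟨h0, ?_⟩
  rw [h2, ← map_mul, h.E_succ n hn, div_mul_cancel₀ _ (h.δ_ne_zero n hn)]
  simp only [map_neg, map_mul, map_ofNat, map_natCast, hφθ]
  ring

theorem PerfectRelations.blockRelation_succ (h : PerfectRelations F k l r lam e1 e2 δ E e)
    (hφ : ∀ x, φ x = x ^ r) (hφθ : φ (thF F k) = thF F k) (hk : 1 ≤ k)
    (hB : ∀ n ≤ 2 * k, ((2 * k).choose n : F) ≠ 0) (hκ : 2 * (k : F) * thF F k ≠ 0)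
    (hl : 1 ≤ l) {n : ℕ} (hn : 1 ≤ n) {x y : F}
    (hx : BlockRelation F k l φ δ E e n x)
    (hxy : y * φ (δ n) * φ (δ (n + 1)) = -(2 * k * thF F k) ^ 2 * x) :
    BlockRelation F k l φ δ E e (n + 1) y := by
  obtain ⟨h0, h1⟩ := h.delta_fIdx_add_top hφ hφθ hk hB hκ hl hn hx
  have hE : φ (E (n + 1)) ≠ 0 := (map_ne_zero φ).2 (h.E_ne_zero _ (by omega))
  have hδ : φ (δ n) ≠ 0 := (map_ne_zero φ).2 (h.δ_ne_zero _ hn)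
  have h2 : φ (e (n + 1)) = (2 * k * thF F k) ^ 2 / φ (δ n) := by
    rw [h.e_succ n hn]
    simp only [map_div₀, map_mul, map_pow, map_natCast, map_ofNat, hφθ]
  rw [BlockRelation, fIdx_succ hn, show fIdx k l n + 2 * k + 1 - 1 = fIdx k l n + 2 * k by omega,
    h1, h2]
  refine mul_right_cancel₀ hδ ?_
  field_simp
  linear_combination hxy

/-- The sequence with `Γ_{n+1} = Γ_n (δ_{n+1} δ_n ω_k)⁻¹` for `n ≥ 1`. -/
def gammaSeq (F : Type*) [Field F] (k : ℕ) (δ : ℕ → F) (g : F) : ℕ → F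
  | 0 => 0
  | 1 => g
  | n + 2 => gammaSeq F k δ g (n + 1) * (δ (n + 2) * δ (n + 1) * omF F k)⁻¹

theorem gammaSeq_succ (g : F) {n : ℕ} (hn : 1 ≤ n) : gammaSeq F k δ g (n + 1) =
    gammaSeq F k δ g n * (δ (n + 1) * δ n * omF F k)⁻¹ := by
  obtain ⟨n, rfl⟩ := Nat.exists_eq_add_of_le' hn
  rfl

theorem gammaSeq_succ_mul (h2 : (2 : F) ≠ 0) (hκ : 2 * (k : F) * thF F k ≠ 0)
    (hδ : ∀ n, 1 ≤ n → δ n ≠ 0) (g : F) {n : ℕ} (hn : 1 ≤ n) :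
    gammaSeq F k δ g (n + 1) =
      -(2 * k * thF F k) ^ 2 * gammaSeq F k δ g n / (δ n * δ (n + 1)) := by
  have := hδ n hn
  have := hδ (n + 1) (by omega)
  rw [gammaSeq_succ g hn, omF_eq h2 hκ]
  have := left_ne_zero_of_mul hκ
  have := right_ne_zero_of_mul hκ
  have := right_ne_zero_of_mul (left_ne_zero_of_mul hκ)
  field_simp

theorem gammaSeq_ne_zero (h2 : (2 : F) ≠ 0) (hκ : 2 * (k : F) * thF F k ≠ 0)
    (hδ : ∀ n, 1 ≤ n → δ n ≠ 0) {g : F} (hg : g ≠ 0) {n : ℕ} (hn : 1 ≤ n) :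
    gammaSeq F k δ g n ≠ 0 := by
  induction n, hn using Nat.le_induction with
  | base => exact hg
  | succ n hn ih =>
    rw [gammaSeq_succ_mul h2 hκ hδ g hn]
    exact div_ne_zero (mul_ne_zero (neg_ne_zero.2 (pow_ne_zero 2 hκ)) ih)
      (mul_ne_zero (hδ n hn) (hδ _ (by omega)))

theorem PerfectRelations.blockRelation_gammaSeq (h : PerfectRelations F k l r lam e1 e2 δ E e)
    (hφ : ∀ x, φ x = x ^ r) (hφθ : φ (thF F k) = thF F k) (h2 : (2 : F) ≠ 0) (hk : 1 ≤ k)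
    (hB : ∀ n ≤ 2 * k, ((2 * k).choose n : F) ≠ 0) (hκ : 2 * (k : F) * thF F k ≠ 0)
    (hl : 1 ≤ l) {g : F} (hg : BlockRelation F k l φ δ E e 1 (φ g)) {n : ℕ} (hn : 1 ≤ n) :
    BlockRelation F k l φ δ E e n (φ (gammaSeq F k δ g n)) := by
  induction n, hn using Nat.le_induction with
  | base => exact hg
  | succ n hn ih =>
    refine h.blockRelation_succ hφ hφθ hk hB hκ hl hn ih ?_
    have h1 := gammaSeq_succ_mul h2 hκ h.δ_ne_zero g hn
    rw [eq_div_iff (mul_ne_zero (h.δ_ne_zero n hn) (h.δ_ne_zero _ (by omega)))] at h1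
    have h3 := congrArg φ h1
    simp only [map_mul, map_neg, map_pow, map_ofNat, map_natCast, hφθ] at h3
    linear_combination h3

theorem PerfectRelations.gammaSeq_fIdx_add (h : PerfectRelations F k l r lam e1 e2 δ E e)
    (hφ : ∀ x, φ x = x ^ r) (hφθ : φ (thF F k) = thF F k) (h2 : (2 : F) ≠ 0) (hk : 1 ≤ k)
    (hB : ∀ n ≤ 2 * k, ((2 * k).choose n : F) ≠ 0) (hκ : 2 * (k : F) * thF F k ≠ 0)
    (hl : 1 ≤ l) {g : F} (hg0 : g ≠ 0) (hg : BlockRelation F k l φ δ E e 1 (φ g)) {n : ℕ}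
    (hn : 1 ≤ n) {j : ℕ} (hj : j ≤ 2 * k) :
    gammaSeq F k δ g (fIdx k l n + j) =
      gammaSeq F k δ g l * φ e1 * (φ (δ 1 * g))⁻¹ * (δ l * omF F k)⁻¹ *
        hF F k j (φ (gammaSeq F k δ g n)) := by
  have hθ := right_ne_zero_of_mul hκ
  have hk0 : (k : F) ≠ 0 := right_ne_zero_of_mul (left_ne_zero_of_mul hκ)
  have hΓ := fun {n : ℕ} (hn : 1 ≤ n) => gammaSeq_ne_zero h2 hκ h.δ_ne_zero hg0 hn
  have hφ0 : ∀ {x : F}, x ≠ 0 → φ x ≠ 0 := fun hx => (map_ne_zero φ).2 hx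
  set Γ := gammaSeq F k δ g with hΓdef
  set C₀ := Γ l * φ e1 * (φ (δ 1 * g))⁻¹ * (δ l * omF F k)⁻¹ with hC₀
  have hrel := fun {n : ℕ} (hn : 1 ≤ n) =>
    h.blockRelation_gammaSeq hφ hφθ h2 hk hB hκ hl hg hn
  have hsucc := fun {n : ℕ} (hn : 1 ≤ n) => gammaSeq_succ_mul h2 hκ h.δ_ne_zero g hn
  rw [← hΓdef] at hrel hsucc
  have hstep : ∀ n, 1 ≤ n → Γ (fIdx k l n) = C₀ * hF F k 0 (φ (Γ n)) →
      ∀ j ≤ 2 * k, Γ (fIdx k l n + j) = C₀ * hF F k j (φ (Γ n)) := by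
    intro n hn h0 j
    have hf := lt_fIdx (k := k) hl hn
    induction j with
    | zero => exact fun _ => h0
    | succ j ih =>
      intro hj
      obtain ⟨ha0, ha1, ha2⟩ := h.delta_block hφ hφθ hk hB hκ hl hn (hrel hn) j (by omega)
      obtain ⟨-, hb1, hb2⟩ := h.delta_block hφ hφθ hk hB hκ hl hn (hrel hn) (j + 1) hj
      have hx0 : -δ n / (2 * k * E n) ≠ 0 := div_ne_zero (neg_ne_zero.2 (h.δ_ne_zero n hn))
        (mul_ne_zero (left_ne_zero_of_mul hκ) (h.E_ne_zero n hn))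
      have hτ := hφ0 (tau_ne_zero hB hx0 (show j ≤ 2 * k by omega))
      have hch := hB j (by omega)
      have hch' := hB (j + 1) hj
      rw [← add_assoc, hsucc (by omega), ih (by omega), add_assoc, ha2, hb2, tau, map_inv₀,
        map_mul, map_chooseRatio, hF_eq hk hθ (by omega), hF_eq hk hθ hj, chooseRatio]
      generalize thF F k + wShift F k j * φ (Γ n) = D₀ at ha0 ⊢
      generalize thF F k + wShift F k (j + 1) * φ (Γ n) = D₁ at ha1 ⊢
      generalize thF F k + wShift F k (j + 1 + 1) * φ (Γ n) = D₂ at hb1 ⊢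
      generalize φ (tau F k (-δ n / (2 * k * E n)) j) = τ at hτ ⊢
      field_simp
      ring
  refine hstep n hn ?_ j hj
  clear hj j
  induction n, hn using Nat.le_induction with
  | base =>
    have h3 := h.delta_fIdx hφ hφθ hl le_rfl (hrel le_rfl)
    have h4 : fIdx k l 1 = l + 1 := by rw [fIdx]; omega
    have h5 := hφ0 (h.E_ne_zero 1 le_rfl)
    have h6 := hφ0 (h.δ_ne_zero 1 le_rfl)
    have h7 := h.δ_ne_zero (l + 1) (by omega)
    have h8 : thF F k + φ (Γ 1) ≠ 0 := by
      intro h8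
      rw [h8, mul_zero, h4] at h3
      exact mul_ne_zero h7 h5 h3
    have h9 := h.δ_ne_zero l hl
    have hg' : Γ 1 = g := rfl
    have := hφ0 hg0
    rw [hF, if_pos rfl, h4, hsucc hl, hC₀, omF_eq h2 hκ]
    rw [h4, h.E_one] at h3
    rw [hg'] at h3 h8 ⊢
    rw [map_mul]
    rw [h.E_one] at h5
    field_simp
    linear_combination Γ l * h3
  | succ n hn ih =>
    have hf := lt_fIdx (k := k) hl hn
    obtain ⟨h0, h1⟩ := h.delta_fIdx_add_top hφ hφθ hk hB hκ hl hn (hrel hn)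
    have h3 := h.delta_fIdx hφ hφθ hl (by omega) (hrel (show 1 ≤ n + 1 by omega))
    have h4 := hstep n hn ih (2 * k) le_rfl
    have h5 := hφ0 (h.E_ne_zero (n + 1) (by omega))
    have h6 := hφ0 (h.δ_ne_zero n hn)
    have h6' := hφ0 (h.δ_ne_zero (n + 1) (by omega))
    have h7 := h.δ_ne_zero (fIdx k l (n + 1)) (by rw [fIdx_succ hn]; omega)
    have h8 : thF F k + φ (Γ (n + 1)) ≠ 0 := by
      intro h8
      rw [h8, mul_zero] at h3
      exact mul_ne_zero h7 h5 h3
    have h9 := congrArg φ (hsucc hn)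
    simp only [map_div₀, map_mul, map_neg, map_pow, map_ofNat, map_natCast, hφθ] at h9
    rw [hF, if_neg (by omega), if_pos rfl] at h4
    rw [fIdx_succ hn] at h3 h7 ⊢
    rw [hsucc (by omega), h4, h1, hF, if_pos rfl, eq_div_of_mul_eq h5 h3]
    rw [eq_div_iff (mul_ne_zero h6 h6')] at h9
    field_simp
    linear_combination -C₀ * h9

end Gamma

theorem memE.two_mul_add_one {p t k : ℕ} (hk : memE p t k) (hp : Odd p) :
    ∃ m j : ℕ, 1 ≤ m ∧ 2 * m + 1 ≤ p ∧ j ≤ t - 1 ∧ 2 * k + 1 = (2 * m + 1) * p ^ j := by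
  obtain ⟨m, j, hm1, hm, hj, rfl⟩ := hk
  refine ⟨m, j, hm1, by omega, hj, ?_⟩
  obtain ⟨c, hc⟩ := hp.pow (n := j)
  rw [hc]
  have : (2 * c + 1 - 1) / 2 = c := by omega
  rw [this]
  ring

section DeltaList
variable {F : Type*} [Field F] {k l r : ℕ} {lam δ E e : ℕ → F} {e1 e2 : F}

theorem deltaList_zero : deltaList F r k e2 lam 0 = [2 * (k : F) * thF F k * e2⁻¹] := rfl

theorem deltaList_succ (n : ℕ) :
    deltaList F r k e2 lam (n + 1) = lam (n + 1) ^ r :: deltaList F r k e2 lam n := by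
  simp [deltaList, List.range_succ_eq_map, Function.comp_def]

theorem deltaList_ne_nil (n : ℕ) : deltaList F r k e2 lam n ≠ [] := by simp [deltaList]

theorem exists_eq_deltaList_of_mem_tails {n : ℕ} {tl : List F}
    (h : tl ∈ (deltaList F r k e2 lam n).tails) (h0 : tl ≠ []) :
    ∃ m ≤ n, tl = deltaList F r k e2 lam m := by
  induction n with
  | zero =>
    rw [deltaList_zero] at h
    simp only [List.tails, List.mem_cons, List.not_mem_nil, or_false, h0] at h
    exact ⟨0, le_rfl, h⟩
  | succ n ih =>
    rw [deltaList_succ, List.tails, List.mem_cons] at h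
    rcases h with rfl | h
    · exact ⟨n + 1, le_rfl, (deltaList_succ n).symm⟩
    · obtain ⟨m, hm, rfl⟩ := ih h
      exact ⟨m, by omega, rfl⟩

theorem cfl_cons {K : Type*} [DivisionRing K] (a : K) {L : List K} (h : L ≠ []) :
    cfl (a :: L) = a + (cfl L)⁻¹ := by
  cases L with
  | nil => exact absurd rfl h
  | cons b L => rfl

theorem PerfectRelations.delta_eq_cfl (h : PerfectRelations F k l r lam e1 e2 δ E e)
    (hκ : 2 * (k : F) * thF F k ≠ 0) {n : ℕ} (hn : 1 ≤ n) (hnl : n ≤ l) :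
    δ n = 2 * (k : F) * thF F k * cfl (deltaList F r k e2 lam n) := by
  induction n, hn using Nat.le_induction with
  | base =>
    rw [h.δ_eq 1 le_rfl, iIdx_of_le hnl, h.e_one, deltaList_succ, cfl_cons _ (deltaList_ne_nil 0),
      deltaList_zero, cfl, mul_inv, inv_inv, mul_add, mul_inv_cancel_left₀ hκ]
    simp
  | succ n hn ih =>
    have := h.δ_ne_zero n hn
    rw [h.δ_eq (n + 1) (by omega), iIdx_of_le hnl, h.e_succ n hn, deltaList_succ,
      cfl_cons _ (deltaList_ne_nil n), eq_div_of_mul_eq hκ ((mul_comm _ _).trans (ih (by omega)).symm)]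
    simp only [Nat.sub_self, pow_zero]
    field_simp

end DeltaList

/-- Theorem B, necessity: if the expansion of `α` is perfect, i.e. there is a sequence
`(λ_n)` in `F_q*` extending the data with the convergents of `[λ₁A_{i(1)}, λ₂A_{i(2)}, …]`
converging to `α`, then `(II)` holds and `(III)` holds: either `δ_l = 4k²θ_k(ε₁/ε₂)^r`, or
`δ_l ≠ 4k²θ_k(ε₁/ε₂)^r` and there is a sequence `(γ_n)` in `F_q*` satisfying `(Γ)`. -/
theorem statement16 (p s t : ℕ) (hp : p.Prime) (hodd : p ≠ 2) (hs : 1 ≤ s) (ht : 1 ≤ t)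
    (Fq : Type*) [Field Fq] [Fintype Fq] (hq : Fintype.card Fq = p ^ s)
    (k : ℕ) (hk : memE p t k) (l : ℕ) (hl : 1 ≤ l)
    (e1 e2 : Fq) (he1 : e1 ≠ 0) (he2 : e2 ≠ 0)
    (lam : ℕ → Fq) (hlam : ∀ n, 1 ≤ n → lam n ≠ 0)
    (α : LaurentSeries Fq) (hord : α ≠ 0 ∧ α.order ≤ -1)
    (heqn : CFtypeEqn Fq (p ^ t) k l lam e1 e2 α)
    (hconv : ConvergesTo Fq (aPQ Fq (p ^ t) k l lam) α) :
    (∀ n, 1 ≤ n → n ≤ l →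
      ∀ tl ∈ (deltaList Fq (p ^ t) k e2 lam n).tails, tl ≠ [] → cfl tl ≠ 0) ∧
    ∃ δ : ℕ → Fq,
      (∀ n, 1 ≤ n → n ≤ l →
        δ n = 2 * (k : Fq) * thF Fq k * cfl (deltaList Fq (p ^ t) k e2 lam n) ∧ δ n ≠ 0) ∧
      (δ l = 4 * (k : Fq) ^ 2 * thF Fq k * (e1 / e2) ^ (p ^ t) ∨
        (δ l ≠ 4 * (k : Fq) ^ 2 * thF Fq k * (e1 / e2) ^ (p ^ t) ∧
          ∃ γ : ℕ → Fq, (∀ n, 1 ≤ n → γ n ≠ 0) ∧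
            γ 1 ^ (p ^ t) =
              (4 * (k : Fq) ^ 2 * thF Fq k * e1 ^ (p ^ t) * (δ l)⁻¹ - e2 ^ (p ^ t)) *
                thF Fq k * δ 1 ^ (-(p ^ t : ℤ)) ∧
            (∀ n, 2 ≤ n → n ≤ l → γ n = γ (n - 1) * (δ n * δ (n - 1) * omF Fq k)⁻¹) ∧
            (∀ n, 1 ≤ n → ∀ i, i ≤ 2 * k →
              γ (fIdx k l n + i) =
                (γ l * e1 ^ (p ^ t) * (δ 1 * γ 1) ^ (-(p ^ t : ℤ)) *
                    (δ l * omF Fq k)⁻¹) * hF Fq k i (γ n ^ (p ^ t))))) := by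
  have := Fact.mk hp
  have : CharP Fq p := charP_of_card_eq_prime_pow hq
  have hp_odd := hp.odd_of_ne_two hodd
  obtain ⟨m, j, hm1, hm, hj, hkm⟩ := hk.two_mul_add_one hp_odd
  have hB : ∀ n ≤ 2 * k, ((2 * k).choose n : Fq) ≠ 0 := fun n hn =>
    choose_ne_zero_of_add_one_eq Fq m j hm (2 * k) n hkm hn
  have hpj : 1 ≤ p ^ j := Nat.one_le_pow _ _ hp.pos
  have hk1 : 1 ≤ k := by nlinarith
  have hkr : 2 * k + 1 ≤ p ^ t := by
    rw [hkm]
    calc (2 * m + 1) * p ^ j ≤ p * p ^ j := Nat.mul_le_mul_right _ hm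
      _ = p ^ (j + 1) := (pow_succ' p j).symm
      _ ≤ p ^ t := Nat.pow_le_pow_right hp.pos (by omega)
  have hk0 : 2 * (k : Fq) ≠ 0 := by simpa using hB 1 (by omega)
  have h2 := left_ne_zero_of_mul hk0
  have hθ : thF Fq k ≠ 0 := thF_ne_zero h2 hB
  have hκ := mul_ne_zero hk0 hθ
  obtain ⟨δ, E, e, h⟩ := perfectRelations h2 hk1 hkr hB hκ hl he1 hlam heqn hconv
  have hδ := fun {n} (hn : 1 ≤ n) (hnl : n ≤ l) => h.delta_eq_cfl hκ hn hnl
  refine ⟨?_, δ, fun n hn hnl => ⟨hδ hn hnl, h.δ_ne_zero n hn⟩, ?_⟩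
  · intro n hn hnl tl htl htl0
    obtain ⟨i, hi, rfl⟩ := exists_eq_deltaList_of_mem_tails htl htl0
    rcases Nat.eq_zero_or_pos i with rfl | hi0
    · exact mul_ne_zero hκ (inv_ne_zero he2)
    · exact right_ne_zero_of_mul (hδ hi0 (hi.trans hnl) ▸ h.δ_ne_zero i hi0)
  refine or_iff_not_imp_left.2 fun hne => ⟨hne, ?_⟩
  set φ := iterateFrobenius Fq p t with hφdef
  have hφ : ∀ x, φ x = x ^ p ^ t := fun x => iterateFrobenius_def p t x
  have hφθ : φ (thF Fq k) = thF Fq k := by rw [hφ, thF_pow h2]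
  obtain ⟨g, hg⟩ := (Finite.injective_iff_surjective.1 φ.injective)
    ((4 * (k : Fq) ^ 2 * thF Fq k * e1 ^ (p ^ t) * (δ l)⁻¹ - e2 ^ (p ^ t)) *
      thF Fq k * (δ 1 ^ p ^ t)⁻¹)
  have hδl := h.δ_ne_zero l hl
  have hδ1 : δ 1 ^ p ^ t ≠ 0 := pow_ne_zero _ (h.δ_ne_zero 1 le_rfl)
  have hg0 : g ≠ 0 := by
    rintro rfl
    rw [map_zero, eq_comm, mul_eq_zero, mul_eq_zero, sub_eq_zero] at hg
    rcases hg with (hg | hg) | hg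
    · have := pow_ne_zero (p ^ t) he2
      refine hne ?_
      rw [div_pow]
      field_simp at hg ⊢
      exact hg.symm
    · exact hθ hg
    · exact inv_ne_zero hδ1 hg
  have hrel : BlockRelation Fq k l φ δ E e 1 (φ g) := by
    rw [BlockRelation, hg, show fIdx k l 1 - 1 = l by rw [fIdx]; omega, h.E_one, h.e_one, hφ, hφ, hφ]
    field_simp
    ring
  refine ⟨gammaSeq Fq k δ g, fun n hn => gammaSeq_ne_zero h2 hκ h.δ_ne_zero hg0 hn, ?_, ?_, ?_⟩
  · rw [zpow_neg, ← Nat.cast_pow (α := ℤ), zpow_natCast, ← hg, hφ]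
    rfl
  · intro n hn _
    obtain ⟨n, rfl⟩ := Nat.exists_eq_add_of_le' (show 1 ≤ n by omega)
    exact gammaSeq_succ g (by omega)
  · intro n hn i hi
    rw [h.gammaSeq_fIdx_add hφ hφθ h2 hk1 hB hκ hl hg0 hrel hn hi, zpow_neg, ← Nat.cast_pow (α := ℤ),
      zpow_natCast, hφ, hφ, hφ]
    rfl
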